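/- arXiv:1411.6985 — 2 statements merged into one kernel-verified Lean document; each statement's English description precedes it below -/
import Mathlib

section
/- Let k be a field, let R1 and R2 be nonzero commutative noetherian k-algebras, let C1 be a semidualizing R1-module and C2 a semidualizing R2-module (so that C1 ⊗_k C2 is a semidualizing (R1 ⊗_k R2)-module), and let N1 be an R1-module and N2 an R2-module. If N1 belongs to the Auslander class A_{C1}(R1) and N2 belongs to the Auslander class A_{C2}(R2), then N1 ⊗_k N2 belongs to the Auslander class A_{C1 ⊗_k C2}(R1 ⊗_k R2). Conversely, if N1 ≠ 0 and N2 ≠ 0 and N1 ⊗_k N2 belongs to A_{C1 ⊗_k C2}(R1 ⊗_k R2), then N1 ∈ A_{C1}(R1) and N2 ∈ A_{C2}(R2). -/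
open TensorProduct CategoryTheory

section TensorModule

variable (k : Type) [CommRing k] (R1 R2 : Type) [CommRing R1] [CommRing R2]
  [Algebra k R1] [Algebra k R2]
variable (M1 M2 : Type) [AddCommGroup M1] [Module k M1] [Module R1 M1] [IsScalarTower k R1 M1]
  [AddCommGroup M2] [Module k M2] [Module R2 M2] [IsScalarTower k R2 M2]

/-- The action of `R2` on `M1 ⊗[k] M2` through the right factor, as an algebra morphism
to endomorphisms. -/
noncomputable def rightSMul : R2 →ₐ[k] Module.End k (M1 ⊗[k] M2) :=
  ((Module.endTensorEndAlgHom (R := k) (S := k) (A := k) (M := M1) (N := M2)).comp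
      (Algebra.TensorProduct.includeRight (R := k) (A := Module.End k M1))).comp
    (Algebra.lsmul k k M2 (A := R2))

/-- The `R2`-module structure on `M1 ⊗[k] M2` via the right factor. -/
noncomputable def rightModule : Module R2 (M1 ⊗[k] M2) :=
  Module.compHom _ (rightSMul k R2 M1 M2).toRingHom

/-- The `R1 ⊗[k] R2`-module structure on `M1 ⊗[k] M2`, characterized by
`(r1 ⊗ r2) • (m1 ⊗ m2) = (r1 • m1) ⊗ (r2 • m2)`; see `tensorModule_smul_tmul`. -/
noncomputable instance (priority := 10) tensorModule :
    Module (R1 ⊗[k] R2) (M1 ⊗[k] M2) :=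
  letI m2 : Module R2 (M1 ⊗[k] M2) := rightModule k R2 M1 M2
  haveI t2 : IsScalarTower k R2 (M1 ⊗[k] M2) := by
    refine IsScalarTower.of_algebraMap_smul (fun r x => ?_)
    show (rightSMul k R2 M1 M2) (algebraMap k R2 r) x = r • x
    rw [AlgHom.commutes]
    simp [Module.algebraMap_end_apply]
  haveI sc : SMulCommClass R1 R2 (M1 ⊗[k] M2) := by
    constructor
    intro r1 r2 x
    show r1 • (rightSMul k R2 M1 M2 r2) x = (rightSMul k R2 M1 M2 r2) (r1 • x)
    induction x using TensorProduct.induction_on with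
    | zero => simp
    | tmul m n =>
        have h1 : (rightSMul k R2 M1 M2 r2) (m ⊗ₜ[k] n) = m ⊗ₜ[k] (r2 • n) := rfl
        have h2 : (rightSMul k R2 M1 M2 r2) ((r1 • m) ⊗ₜ[k] n) = (r1 • m) ⊗ₜ[k] (r2 • n) := rfl
        rw [h1, smul_tmul', smul_tmul', h2]
    | add x y hx hy =>
        calc r1 • (rightSMul k R2 M1 M2 r2) (x + y)
            = r1 • ((rightSMul k R2 M1 M2 r2) x + (rightSMul k R2 M1 M2 r2) y) := by
              rw [(rightSMul k R2 M1 M2 r2).map_add]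
          _ = r1 • (rightSMul k R2 M1 M2 r2) x + r1 • (rightSMul k R2 M1 M2 r2) y :=
              smul_add _ _ _
          _ = (rightSMul k R2 M1 M2 r2) (r1 • x) + (rightSMul k R2 M1 M2 r2) (r1 • y) := by
              rw [hx, hy]
          _ = (rightSMul k R2 M1 M2 r2) (r1 • x + r1 • y) :=
              ((rightSMul k R2 M1 M2 r2).map_add _ _).symm
          _ = (rightSMul k R2 M1 M2 r2) (r1 • (x + y)) := by rw [smul_add]
  TensorProduct.Algebra.module

/-- The defining property of the `R1 ⊗[k] R2`-module structure on `M1 ⊗[k] M2`. -/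
lemma tensorModule_smul_tmul (r1 : R1) (r2 : R2) (m : M1) (n : M2) :
    (r1 ⊗ₜ[k] r2 : R1 ⊗[k] R2) • (m ⊗ₜ[k] n : M1 ⊗[k] M2) = (r1 • m) ⊗ₜ[k] (r2 • n) := rfl

end TensorModule

section HomAlg

variable (R : Type) [CommRing R]

/-- The `i`-th Ext group `Ext_R^i(M, N)`. -/
noncomputable def extGroup (M N : Type) [AddCommGroup M] [Module R M]
    [AddCommGroup N] [Module R N] (i : ℕ) : Type :=
  (((Ext R (ModuleCat R) i).obj (Opposite.op (ModuleCat.of R M))).obj (ModuleCat.of R N) :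
    ModuleCat R)

/-- The `i`-th Tor group `Tor_i^R(M, N)`. -/
noncomputable def torGroup (M N : Type) [AddCommGroup M] [Module R M]
    [AddCommGroup N] [Module R N] (i : ℕ) : Type :=
  (((Tor (ModuleCat R) i).obj (ModuleCat.of R M)).obj (ModuleCat.of R N) : ModuleCat R)

/-- `C` is a semidualizing `R`-module: it is finitely generated, the homothety map
`R → Hom_R(C,C)`, `r ↦ (x ↦ r • x)`, is bijective, and `Ext_R^i(C,C) = 0` for all `i > 0`. -/
noncomputable def IsSemidualizing (C : Type) [AddCommGroup C] [Module R C] : Prop :=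
  Module.Finite R C ∧
  Function.Bijective (LinearMap.lsmul R C) ∧
  ∀ i : ℕ, 0 < i → Subsingleton (extGroup R C C i)

end HomAlg

section Auslander

open TensorProduct

variable (R : Type) [CommRing R]

/-- `M` belongs to the Auslander class `A_C(R)`: the natural map
`M → Hom_R(C, C ⊗_R M)`, `m ↦ (c ↦ c ⊗ m)`, is bijective, and
`Tor_i^R(C,M) = 0 = Ext_R^i(C, C ⊗_R M)` for all `i > 0`. -/
noncomputable def MemAuslanderClass (C M : Type) [AddCommGroup C] [Module R C]
    [AddCommGroup M] [Module R M] : Prop :=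
  Function.Bijective ((TensorProduct.mk R C M).flip : M →ₗ[R] (C →ₗ[R] C ⊗[R] M)) ∧
  (∀ i : ℕ, 0 < i → Subsingleton (torGroup R C M i)) ∧
  (∀ i : ℕ, 0 < i → Subsingleton (extGroup R C (C ⊗[R] M) i))

end Auslander

section ExtVanishes

/-- The vanishing of `Ext_R^{n+1}(X, M)`. -/
def ExtVanishes (R : Type) [CommRing R] (X M : Type) [AddCommGroup X] [Module R X]
    [AddCommGroup M] [Module R M] (n : ℕ) : Prop :=
  Subsingleton (Abelian.Ext (ModuleCat.of R X) (ModuleCat.of R M) (n + 1))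

variable {R : Type} [CommRing R] {X X' K P M M' : Type}
  [AddCommGroup X] [Module R X] [AddCommGroup X'] [Module R X']
  [AddCommGroup K] [Module R K] [AddCommGroup P] [Module R P]
  [AddCommGroup M] [Module R M] [AddCommGroup M'] [Module R M']

namespace ExtVanishes

lemma of_projective [Module.Projective R P] (n : ℕ) : ExtVanishes R P M n :=
  Abelian.Ext.subsingleton_of_projective _ _ n

lemma congr {n : ℕ} (h : ExtVanishes R X M n) (e : X ≃ₗ[R] X') (e' : M ≃ₗ[R] M') :
    ExtVanishes R X' M' n := by
  have h : Subsingleton (Abelian.Ext (ModuleCat.of R X) (ModuleCat.of R M) (n + 1)) := h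
  refine subsingleton_of_forall_eq 0 fun z => ?_
  generalize e.toModuleIso = E, e'.toModuleIso = E'
  have key := congrArg (fun w => ((Abelian.Ext.mk₀ E.inv).comp w (zero_add _)).comp
    (Abelian.Ext.mk₀ E'.hom) (add_zero _))
    (Subsingleton.elim (((Abelian.Ext.mk₀ E.hom).comp z (zero_add _)).comp
      (Abelian.Ext.mk₀ E'.inv) (add_zero _)) 0)
  simpa using key

section

variable {f : K →ₗ[R] P} {g : P →ₗ[R] X}

lemma _root_.shortExact_of_function_exact (hf : Function.Injective f) (hfg : Function.Exact f g)
    (hg : Function.Surjective g) :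
    (ModuleCat.shortComplexOfCompEqZero f g hfg.linearMap_comp_eq_zero).ShortExact :=
  ModuleCat.shortComplex_shortExact _ hfg hf hg

lemma exists_extension (hf : Function.Injective f) (hfg : Function.Exact f g)
    (hg : Function.Surjective g) (h : ExtVanishes R X M 0) (φ : K →ₗ[R] M) :
    ∃ ψ : P →ₗ[R] M, ψ ∘ₗ f = φ := by
  obtain ⟨x, hx⟩ := Abelian.Ext.contravariant_sequence_exact₁
    (shortExact_of_function_exact hf hfg hg) (ModuleCat.of R M)
    (Abelian.Ext.mk₀ (ModuleCat.ofHom φ)) (n₁ := 1) rfl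
    (@Subsingleton.elim _ h _ _)
  obtain ⟨x, rfl⟩ := (Abelian.Ext.mk₀_bijective _ _).2 x
  rw [Abelian.Ext.mk₀_comp_mk₀] at hx
  exact ⟨x.hom, congrArg ModuleCat.Hom.hom ((Abelian.Ext.mk₀_bijective _ _).1 hx)⟩

lemma of_exists_extension (hf : Function.Injective f) (hfg : Function.Exact f g)
    (hg : Function.Surjective g) (hP : ExtVanishes R P M 0)
    (h : ∀ φ : K →ₗ[R] M, ∃ ψ : P →ₗ[R] M, ψ ∘ₗ f = φ) : ExtVanishes R X M 0 := by
  have hS := shortExact_of_function_exact hf hfg hg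
  refine subsingleton_of_forall_eq 0 fun x => ?_
  obtain ⟨y, rfl⟩ := Abelian.Ext.contravariant_sequence_exact₃ hS _ x (@Subsingleton.elim _ hP _ _)
    (n₀ := 0) rfl
  obtain ⟨φ, rfl⟩ := (Abelian.Ext.mk₀_bijective _ _).2 y
  obtain ⟨ψ, hψ⟩ := h φ.hom
  have : φ = ModuleCat.ofHom f ≫ ModuleCat.ofHom ψ := by
    ext x; exact (LinearMap.congr_fun hψ x).symm
  rw [this, ← Abelian.Ext.mk₀_comp_mk₀]
  exact hS.extClass_comp_assoc (Abelian.Ext.mk₀ (ModuleCat.ofHom ψ)) (h := rfl)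

lemma ker_of_succ {n : ℕ} (hf : Function.Injective f) (hfg : Function.Exact f g)
    (hg : Function.Surjective g)
    (hP : ExtVanishes R P M n) (hX : ExtVanishes R X M (n + 1)) :
    ExtVanishes R K M n := by
  refine subsingleton_of_forall_eq 0 fun x => ?_
  obtain ⟨y, rfl⟩ := Abelian.Ext.contravariant_sequence_exact₁
    (shortExact_of_function_exact hf hfg hg) _ x (n₁ := n + 1 + 1) (add_comm _ _)
    (@Subsingleton.elim _ hX _ _)
  rw [@Subsingleton.elim _ hP y 0, Abelian.Ext.comp_zero]

lemma succ_of_ker {n : ℕ} (hf : Function.Injective f) (hfg : Function.Exact f g)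
    (hg : Function.Surjective g)
    (hP : ExtVanishes R P M (n + 1)) (hK : ExtVanishes R K M n) :
    ExtVanishes R X M (n + 1) := by
  refine subsingleton_of_forall_eq 0 fun x => ?_
  obtain ⟨y, rfl⟩ := Abelian.Ext.contravariant_sequence_exact₃
    (shortExact_of_function_exact hf hfg hg) _ x (@Subsingleton.elim _ hP _ _)
    (n₀ := n + 1) (add_comm _ _)
  rw [@Subsingleton.elim _ hK y 0, Abelian.Ext.comp_zero]

end

end ExtVanishes
end ExtVanishes

section ExtVanishes

variable {R R' : Type} [CommRing R] [CommRing R'] {X K P M X' K' P' M' : Type}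
  [AddCommGroup X] [Module R X] [AddCommGroup K] [Module R K] [AddCommGroup P] [Module R P]
  [AddCommGroup M] [Module R M] [AddCommGroup X'] [Module R' X']
  [AddCommGroup K'] [Module R' K'] [AddCommGroup P'] [Module R' P']
  [AddCommGroup M'] [Module R' M']

/-- Transfer of vanishing of `Ext^1` along a natural bijection of `Hom` groups. -/
lemma ExtVanishes.zero_of_equiv {f : K →ₗ[R] P} {g : P →ₗ[R] X} (hf : Function.Injective f)
    (hfg : Function.Exact f g) (hg : Function.Surjective g)
    {f' : K' →ₗ[R'] P'} {g' : P' →ₗ[R'] X'} (hf' : Function.Injective f')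
    (hfg' : Function.Exact f' g') (hg' : Function.Surjective g')
    (eK : (K →ₗ[R] M) ≃ (K' →ₗ[R'] M')) (eP : (P →ₗ[R] M) ≃ (P' →ₗ[R'] M'))
    (comm : ∀ ψ, eK (ψ ∘ₗ f) = eP ψ ∘ₗ f') (hP : ExtVanishes R P M 0)
    (h : ExtVanishes R' X' M' 0) : ExtVanishes R X M 0 := by
  refine of_exists_extension hf hfg hg hP fun φ => ?_
  obtain ⟨ψ, hψ⟩ := h.exists_extension hf' hfg' hg' (eK φ)
  exact ⟨eP.symm ψ, eK.injective (by rw [comm, eP.apply_symm_apply, hψ])⟩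

end ExtVanishes

section TensorExt

variable {k R1 R2 : Type} [Field k] [CommRing R1] [CommRing R2] [Algebra k R1] [Algebra k R2]
  {X1 X2 Y1 Y2 Z1 Z2 : Type}
  [AddCommGroup X1] [Module k X1] [Module R1 X1] [IsScalarTower k R1 X1]
  [AddCommGroup X2] [Module k X2] [Module R2 X2] [IsScalarTower k R2 X2]
  [AddCommGroup Y1] [Module k Y1] [Module R1 Y1] [IsScalarTower k R1 Y1]
  [AddCommGroup Y2] [Module k Y2] [Module R2 Y2] [IsScalarTower k R2 Y2]
  [AddCommGroup Z1] [Module k Z1] [Module R1 Z1] [IsScalarTower k R1 Z1]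
  [AddCommGroup Z2] [Module k Z2] [Module R2 Z2] [IsScalarTower k R2 Z2]

/-- An additive map out of `X1 ⊗[k] X2` that is compatible with pure tensors is
`R1 ⊗[k] R2`-linear. -/
lemma map_smul_of_tmul {M : Type} [AddCommGroup M] [Module (R1 ⊗[k] R2) M]
    (φ : X1 ⊗[k] X2 →+ M)
    (h : ∀ (r1 : R1) (r2 : R2) (x1 : X1) (x2 : X2),
      φ ((r1 • x1) ⊗ₜ (r2 • x2)) = (r1 ⊗ₜ[k] r2) • φ (x1 ⊗ₜ x2))
    (r : R1 ⊗[k] R2) (x : X1 ⊗[k] X2) : φ (r • x) = r • φ x := by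
  induction r with
  | zero => simp
  | add r s hr hs => rw [add_smul, map_add, hr, hs, add_smul]
  | tmul r1 r2 =>
    induction x with
    | zero => simp
    | add x y hx hy => rw [smul_add, map_add, hx, hy, map_add, smul_add]
    | tmul x1 x2 => rw [tensorModule_smul_tmul, h]

/-- The tensor product of an `R1`-linear and an `R2`-linear map. -/
noncomputable def tensorMap (f : X1 →ₗ[R1] Y1) (g : X2 →ₗ[R2] Y2) :
    X1 ⊗[k] X2 →ₗ[R1 ⊗[k] R2] Y1 ⊗[k] Y2 where
  toFun := TensorProduct.map (f.restrictScalars k) (g.restrictScalars k)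
  map_add' := map_add _
  map_smul' := map_smul_of_tmul
    (TensorProduct.map (f.restrictScalars k) (g.restrictScalars k)).toAddMonoidHom
    fun r1 r2 x1 x2 => by simp [tensorModule_smul_tmul]

@[simp]
lemma tensorMap_tmul (f : X1 →ₗ[R1] Y1) (g : X2 →ₗ[R2] Y2) (x1 : X1) (x2 : X2) :
    tensorMap (k := k) f g (x1 ⊗ₜ x2) = f x1 ⊗ₜ g x2 := rfl

/-- The tensor product of linear equivalences over `R1` and `R2`. -/
noncomputable def tensorCongr (e1 : X1 ≃ₗ[R1] Y1) (e2 : X2 ≃ₗ[R2] Y2) :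
    X1 ⊗[k] X2 ≃ₗ[R1 ⊗[k] R2] Y1 ⊗[k] Y2 where
  __ := tensorMap (k := k) e1.toLinearMap e2.toLinearMap
  invFun := tensorMap (k := k) e1.symm.toLinearMap e2.symm.toLinearMap
  left_inv x := by
    induction x with
    | zero => simp
    | add x y hx hy => simp_all
    | tmul x y => simp
  right_inv x := by
    induction x with
    | zero => simp
    | add x y hx hy => simp_all
    | tmul x y => simp

section Free

variable (k R1 R2) (ι κ : Type)

/-- The tensor product of free modules is free. -/
noncomputable def tensorFinsupp :
    (ι →₀ R1) ⊗[k] (κ →₀ R2) ≃ₗ[R1 ⊗[k] R2] ι × κ →₀ R1 ⊗[k] R2 where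
  __ := (finsuppTensorFinsupp k k R1 R2 ι κ).toAddEquiv
  map_smul' := map_smul_of_tmul (finsuppTensorFinsupp k k R1 R2 ι κ).toAddEquiv.toAddMonoidHom
    fun r1 r2 x1 x2 => by
      ext ⟨i, j⟩
      simp

instance : Module.Projective (R1 ⊗[k] R2) ((ι →₀ R1) ⊗[k] (κ →₀ R2)) :=
  Module.Projective.of_equiv (tensorFinsupp k R1 R2 ι κ).symm

end Free

/-- The `R1 ⊗[k] R2`-module structure on `M` is induced by commuting actions. -/
def IsTensorAction (k R1 R2 M : Type) [Field k] [CommRing R1] [CommRing R2] [Algebra k R1]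
    [Algebra k R2] [AddCommGroup M] [Module R1 M] [Module R2 M] [Module (R1 ⊗[k] R2) M] : Prop :=
  ∀ (r1 : R1) (r2 : R2) (m : M), (r1 ⊗ₜ[k] r2 : R1 ⊗[k] R2) • m = r1 • r2 • m

section Adjunction

variable {M : Type} [AddCommGroup M] [Module k M] [Module R1 M] [Module R2 M]
  [IsScalarTower k R1 M] [IsScalarTower k R2 M] [SMulCommClass R1 R2 M] [SMulCommClass R2 R1 M]
  [Module (R1 ⊗[k] R2) M] (hM : IsTensorAction k R1 R2 M)

/-- The tensor-hom adjunction for the outer tensor product. -/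
noncomputable def tensorHomEquiv :
    (X1 ⊗[k] X2 →ₗ[R1 ⊗[k] R2] M) ≃ (X1 →ₗ[R1] X2 →ₗ[R2] M) where
  toFun φ :=
    { toFun x1 :=
        { toFun x2 := φ (x1 ⊗ₜ x2)
          map_add' x y := by rw [tmul_add, map_add]
          map_smul' r x := by
            have := φ.map_smul (1 ⊗ₜ r) (x1 ⊗ₜ x)
            rwa [tensorModule_smul_tmul, hM, one_smul, one_smul] at this }
      map_add' x y := by ext; simp [add_tmul]
      map_smul' r x := by
        ext x2
        have := φ.map_smul (r ⊗ₜ 1) (x ⊗ₜ x2)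
        rwa [tensorModule_smul_tmul, hM, one_smul, one_smul] at this }
  invFun β :=
    let b : X1 →ₗ[k] X2 →ₗ[k] M := LinearMap.mk₂ k (fun x1 x2 => β x1 x2)
      (by simp) (fun c x y => by
        rw [← algebraMap_smul R1 c x, map_smul, LinearMap.smul_apply, algebraMap_smul])
      (by simp) (fun c x y => by rw [← algebraMap_smul R2 c y, map_smul, algebraMap_smul])
    { toFun := TensorProduct.lift b
      map_add' := map_add _
      map_smul' := map_smul_of_tmul (TensorProduct.lift b).toAddMonoidHom
        fun r1 r2 x1 x2 => by simp [hM _ _ _, b, smul_comm r1 r2] }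
  left_inv φ := by
    ext x
    induction x with
    | zero => simp
    | add x y hx hy => rw [map_add, hx, hy, map_add]
    | tmul x y => rfl
  right_inv β := rfl

/-- Exchanging the arguments of a bilinear map over two rings. -/
def biFlip : (X1 →ₗ[R1] X2 →ₗ[R2] M) ≃ (X2 →ₗ[R2] X1 →ₗ[R1] M) where
  toFun β :=
    { toFun x2 :=
        { toFun x1 := β x1 x2
          map_add' := by simp
          map_smul' := by simp }
      map_add' _ _ := by ext; simp
      map_smul' _ _ := by ext; simp }
  invFun β :=
    { toFun x2 :=
        { toFun x1 := β x1 x2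
          map_add' := by simp
          map_smul' := by simp }
      map_add' _ _ := by ext; simp
      map_smul' _ _ := by ext; simp }

end Adjunction

end TensorExt

section ExtVanishes

variable {R : Type} [CommRing R] {X M M' : Type} [AddCommGroup X] [Module R X]
  [AddCommGroup M] [Module R M] [AddCommGroup M'] [Module R M']

/-- A presentation of a module by a free module. -/
lemma exists_exact_finsupp (k R X : Type) [Field k] [CommRing R] [Algebra k R] [AddCommGroup X]
    [Module R X] :
    ∃ (K : Type) (_ : AddCommGroup K) (_ : Module k K) (_ : Module R K) (_ : IsScalarTower k R K)
      (f : K →ₗ[R] (X →₀ R)) (g : (X →₀ R) →ₗ[R] X),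
      Function.Injective f ∧ Function.Exact f g ∧ Function.Surjective g :=
  ⟨LinearMap.ker (Finsupp.linearCombination R (id : X → X)), inferInstance, inferInstance,
    inferInstance, inferInstance, _, _, Submodule.subtype_injective _,
    LinearMap.exact_subtype_ker_map _, Finsupp.linearCombination_id_surjective R X⟩

namespace ExtVanishes

lemma of_retract {n : ℕ} (h : ExtVanishes R X M' n) (i : M →ₗ[R] M') (p : M' →ₗ[R] M)
    (hpi : p ∘ₗ i = LinearMap.id) : ExtVanishes R X M n := by
  have h : Subsingleton (Abelian.Ext (ModuleCat.of R X) (ModuleCat.of R M') (n + 1)) := h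
  refine subsingleton_of_forall_eq 0 fun z => ?_
  have key := congrArg (fun w => w.comp (Abelian.Ext.mk₀ (ModuleCat.ofHom p)) (add_zero _))
    (Subsingleton.elim (z.comp (Abelian.Ext.mk₀ (ModuleCat.ofHom i)) (add_zero _)) 0)
  simpa [← ModuleCat.ofHom_comp, hpi] using key

lemma pi_const {n : ℕ} (B : Type) (h : ExtVanishes R X M n) : ExtVanishes R X (B → M) n := by
  induction n generalizing X with
  | zero =>
    refine of_exists_extension (Submodule.subtype_injective _)
      (LinearMap.exact_subtype_ker_map _) (Finsupp.linearCombination_id_surjective R X)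
      (of_projective 0) fun φ => ?_
    choose ψ hψ using fun b => h.exists_extension (Submodule.subtype_injective _)
      (LinearMap.exact_subtype_ker_map _) (Finsupp.linearCombination_id_surjective R X)
      (LinearMap.proj b ∘ₗ φ)
    exact ⟨LinearMap.pi ψ, LinearMap.ext fun x => funext fun b => LinearMap.congr_fun (hψ b) x⟩
  | succ n ih =>
    have hs := Finsupp.linearCombination_id_surjective R X
    exact succ_of_ker (Submodule.subtype_injective _) (LinearMap.exact_subtype_ker_map _) hs
      (of_projective _) (ih (ker_of_succ (Submodule.subtype_injective _)
        (LinearMap.exact_subtype_ker_map _) hs (of_projective _) h))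

lemma of_pi_const {n : ℕ} {B : Type} [Nonempty B] (h : ExtVanishes R X (B → M) n) :
    ExtVanishes R X M n :=
  h.of_retract (LinearMap.pi fun _ => LinearMap.id)
    (LinearMap.proj (Classical.arbitrary B)) rfl

lemma finsupp [IsNoetherianRing R] [Module.Finite R X] {n : ℕ} (B : Type)
    (h : ExtVanishes R X M n) : ExtVanishes R X (B →₀ M) n := by
  induction n generalizing X with
  | zero =>
    obtain ⟨m, g, hg⟩ := Module.Finite.exists_fin' R X
    refine of_exists_extension (Submodule.subtype_injective _) (LinearMap.exact_subtype_ker_map g)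
      hg (of_projective 0) fun φ => ?_
    choose ψ hψ using fun b => h.exists_extension (Submodule.subtype_injective _)
      (LinearMap.exact_subtype_ker_map g) hg (Finsupp.lapply b ∘ₗ φ)
    classical
    obtain ⟨s, hs⟩ := (Module.Finite.fg_top : (⊤ : Submodule R (LinearMap.ker g)).FG)
    let F := s.biUnion fun x => (φ x).support
    have hF (x) : (φ x) ∈ Finsupp.supported M R (F : Set B) := by
      have : (⊤ : Submodule R (LinearMap.ker g)) ≤
          (Finsupp.supported M R (F : Set B)).comap φ := by
        rw [← hs, Submodule.span_le]
        intro y hy b hb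
        exact Finset.mem_biUnion.2 ⟨y, hy, hb⟩
      exact this (Submodule.mem_top : x ∈ ⊤)
    refine ⟨∑ b ∈ F, Finsupp.lsingle b ∘ₗ ψ b, LinearMap.ext fun x => ?_⟩
    have hx (b) : ψ b x = φ x b := LinearMap.congr_fun (hψ b) x
    simp only [LinearMap.comp_apply, LinearMap.sum_apply, Submodule.subtype_apply,
      Finsupp.lsingle_apply, hx]
    exact (Finsupp.sum_of_support_subset (φ x) (hF x) _ (by simp)).symm.trans (Finsupp.sum_single _)
  | succ n ih =>
    obtain ⟨m, g, hg⟩ := Module.Finite.exists_fin' R X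
    exact succ_of_ker (Submodule.subtype_injective _) (LinearMap.exact_subtype_ker_map _) hg
      (of_projective _) (ih (ker_of_succ (Submodule.subtype_injective _)
        (LinearMap.exact_subtype_ker_map _) hg (of_projective _) h))

lemma of_finsupp {n : ℕ} {B : Type} [Nonempty B] (h : ExtVanishes R X (B →₀ M) n) :
    ExtVanishes R X M n :=
  h.of_retract (Finsupp.lsingle (Classical.arbitrary B)) (Finsupp.lapply (Classical.arbitrary B))
    (by ext; simp)

end ExtVanishes
end ExtVanishes

section TensorExt

variable {k R1 R2 : Type} [Field k] [CommRing R1] [CommRing R2] [Algebra k R1] [Algebra k R2]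
  {X1 X2 Y1 Y2 Z1 Z2 : Type}
  [AddCommGroup X1] [Module k X1] [Module R1 X1] [IsScalarTower k R1 X1]
  [AddCommGroup X2] [Module k X2] [Module R2 X2] [IsScalarTower k R2 X2]
  [AddCommGroup Y1] [Module k Y1] [Module R1 Y1] [IsScalarTower k R1 Y1]
  [AddCommGroup Y2] [Module k Y2] [Module R2 Y2] [IsScalarTower k R2 Y2]
  [AddCommGroup Z1] [Module k Z1] [Module R1 Z1] [IsScalarTower k R1 Z1]
  [AddCommGroup Z2] [Module k Z2] [Module R2 Z2] [IsScalarTower k R2 Z2]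

section Exact

lemma tensorMap_id_right_injective {f : X1 →ₗ[R1] Y1} (hf : Function.Injective f) :
    Function.Injective (tensorMap (k := k) f (LinearMap.id : X2 →ₗ[R2] X2)) :=
  Module.Flat.rTensor_preserves_injective_linearMap (f.restrictScalars k) hf

lemma tensorMap_id_left_injective {g : X2 →ₗ[R2] Y2} (hg : Function.Injective g) :
    Function.Injective (tensorMap (k := k) (LinearMap.id : X1 →ₗ[R1] X1) g) :=
  Module.Flat.lTensor_preserves_injective_linearMap (g.restrictScalars k) hg

lemma tensorMap_id_right_surjective {f : X1 →ₗ[R1] Y1} (hf : Function.Surjective f) :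
    Function.Surjective (tensorMap (k := k) f (LinearMap.id : X2 →ₗ[R2] X2)) :=
  LinearMap.rTensor_surjective X2 (g := f.restrictScalars k) hf

lemma tensorMap_id_left_surjective {g : X2 →ₗ[R2] Y2} (hg : Function.Surjective g) :
    Function.Surjective (tensorMap (k := k) (LinearMap.id : X1 →ₗ[R1] X1) g) :=
  LinearMap.lTensor_surjective X1 (g := g.restrictScalars k) hg

lemma tensorMap_id_right_exact {f : X1 →ₗ[R1] Y1} {g : Y1 →ₗ[R1] Z1} (hfg : Function.Exact f g)
    (hg : Function.Surjective g) :
    Function.Exact (tensorMap (k := k) f (LinearMap.id : X2 →ₗ[R2] X2))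
      (tensorMap (k := k) g (LinearMap.id : X2 →ₗ[R2] X2)) :=
  rTensor_exact X2 (f := f.restrictScalars k) (g := g.restrictScalars k) hfg hg

lemma tensorMap_id_left_exact {f : X2 →ₗ[R2] Y2} {g : Y2 →ₗ[R2] Z2} (hfg : Function.Exact f g)
    (hg : Function.Surjective g) :
    Function.Exact (tensorMap (k := k) (LinearMap.id : X1 →ₗ[R1] X1) f)
      (tensorMap (k := k) (LinearMap.id : X1 →ₗ[R1] X1) g) :=
  lTensor_exact X1 (f := f.restrictScalars k) (g := g.restrictScalars k) hfg hg

end Exact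

variable {M : Type} [AddCommGroup M] [Module k M] [Module R1 M] [Module R2 M]
  [IsScalarTower k R1 M] [IsScalarTower k R2 M] [SMulCommClass R1 R2 M] [SMulCommClass R2 R1 M]
  [Module (R1 ⊗[k] R2) M]

namespace ExtVanishes

lemma tensor_of_hom_left (hM : IsTensorAction k R1 R2 M) {n : ℕ}
    (hfree : ∀ (ι : Type) (j : ℕ), j ≤ n → ExtVanishes (R1 ⊗[k] R2) ((ι →₀ R1) ⊗[k] X2) M j)
    (h : ExtVanishes R1 X1 (X2 →ₗ[R2] M) n) : ExtVanishes (R1 ⊗[k] R2) (X1 ⊗[k] X2) M n := by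
  induction n generalizing X1 with
  | zero =>
    obtain ⟨K, _, _, _, _, f, g, hi, he, hs⟩ := exists_exact_finsupp k R1 X1
    have ti : Function.Injective (tensorMap (k := k) f (LinearMap.id : X2 →ₗ[R2] X2)) :=
      tensorMap_id_right_injective hi
    have te : Function.Exact (tensorMap (k := k) f (LinearMap.id : X2 →ₗ[R2] X2))
        (tensorMap (k := k) g (LinearMap.id : X2 →ₗ[R2] X2)) :=
      tensorMap_id_right_exact he hs
    have ts : Function.Surjective (tensorMap (k := k) g (LinearMap.id : X2 →ₗ[R2] X2)) :=
      tensorMap_id_right_surjective hs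
    exact zero_of_equiv ti te ts hi he hs
      (tensorHomEquiv hM) (tensorHomEquiv hM) (fun _ => rfl) (hfree _ 0 le_rfl) h
  | succ n ih =>
    obtain ⟨K, _, _, _, _, f, g, hi, he, hs⟩ := exists_exact_finsupp k R1 X1
    have ti : Function.Injective (tensorMap (k := k) f (LinearMap.id : X2 →ₗ[R2] X2)) :=
      tensorMap_id_right_injective hi
    have te : Function.Exact (tensorMap (k := k) f (LinearMap.id : X2 →ₗ[R2] X2))
        (tensorMap (k := k) g (LinearMap.id : X2 →ₗ[R2] X2)) :=
      tensorMap_id_right_exact he hs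
    have ts : Function.Surjective (tensorMap (k := k) g (LinearMap.id : X2 →ₗ[R2] X2)) :=
      tensorMap_id_right_surjective hs
    exact succ_of_ker ti te ts (hfree _ _ le_rfl)
      (ih (fun ι j hj => hfree ι j (hj.trans n.le_succ))
        (ker_of_succ hi he hs (of_projective _) h))

lemma hom_left_of_tensor (hM : IsTensorAction k R1 R2 M) {n : ℕ}
    (hfree : ∀ (ι : Type) (j : ℕ), j < n → ExtVanishes (R1 ⊗[k] R2) ((ι →₀ R1) ⊗[k] X2) M j)
    (h : ExtVanishes (R1 ⊗[k] R2) (X1 ⊗[k] X2) M n) : ExtVanishes R1 X1 (X2 →ₗ[R2] M) n := by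
  induction n generalizing X1 with
  | zero =>
    obtain ⟨K, _, _, _, _, f, g, hi, he, hs⟩ := exists_exact_finsupp k R1 X1
    have ti : Function.Injective (tensorMap (k := k) f (LinearMap.id : X2 →ₗ[R2] X2)) :=
      tensorMap_id_right_injective hi
    have te : Function.Exact (tensorMap (k := k) f (LinearMap.id : X2 →ₗ[R2] X2))
        (tensorMap (k := k) g (LinearMap.id : X2 →ₗ[R2] X2)) :=
      tensorMap_id_right_exact he hs
    have ts : Function.Surjective (tensorMap (k := k) g (LinearMap.id : X2 →ₗ[R2] X2)) :=
      tensorMap_id_right_surjective hs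
    exact zero_of_equiv hi he hs ti te ts
      (tensorHomEquiv hM).symm (tensorHomEquiv hM).symm
      (fun ψ => (tensorHomEquiv hM).injective (by
        rw [Equiv.apply_symm_apply]
        conv_lhs => rw [← (tensorHomEquiv hM).apply_symm_apply ψ]
        rfl)) (of_projective _) h
  | succ n ih =>
    obtain ⟨K, _, _, _, _, f, g, hi, he, hs⟩ := exists_exact_finsupp k R1 X1
    have ti : Function.Injective (tensorMap (k := k) f (LinearMap.id : X2 →ₗ[R2] X2)) :=
      tensorMap_id_right_injective hi
    have te : Function.Exact (tensorMap (k := k) f (LinearMap.id : X2 →ₗ[R2] X2))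
        (tensorMap (k := k) g (LinearMap.id : X2 →ₗ[R2] X2)) :=
      tensorMap_id_right_exact he hs
    have ts : Function.Surjective (tensorMap (k := k) g (LinearMap.id : X2 →ₗ[R2] X2)) :=
      tensorMap_id_right_surjective hs
    exact succ_of_ker hi he hs (of_projective _)
      (ih (fun ι j hj => hfree ι j (hj.trans n.lt_succ_self))
        (ker_of_succ ti te ts (hfree _ _ n.lt_succ_self) h))

lemma tensor_of_hom_right (hM : IsTensorAction k R1 R2 M) {n : ℕ}
    (hfree : ∀ (ι : Type) (j : ℕ), j ≤ n → ExtVanishes (R1 ⊗[k] R2) (X1 ⊗[k] (ι →₀ R2)) M j)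
    (h : ExtVanishes R2 X2 (X1 →ₗ[R1] M) n) : ExtVanishes (R1 ⊗[k] R2) (X1 ⊗[k] X2) M n := by
  induction n generalizing X2 with
  | zero =>
    obtain ⟨K, _, _, _, _, f, g, hi, he, hs⟩ := exists_exact_finsupp k R2 X2
    have ti : Function.Injective (tensorMap (k := k) (LinearMap.id : X1 →ₗ[R1] X1) f) :=
      tensorMap_id_left_injective hi
    have te : Function.Exact (tensorMap (k := k) (LinearMap.id : X1 →ₗ[R1] X1) f)
        (tensorMap (k := k) (LinearMap.id : X1 →ₗ[R1] X1) g) :=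
      tensorMap_id_left_exact he hs
    have ts : Function.Surjective (tensorMap (k := k) (LinearMap.id : X1 →ₗ[R1] X1) g) :=
      tensorMap_id_left_surjective hs
    exact zero_of_equiv ti te ts hi he hs
      ((tensorHomEquiv hM).trans biFlip) ((tensorHomEquiv hM).trans biFlip) (fun _ => rfl)
      (hfree _ 0 le_rfl) h
  | succ n ih =>
    obtain ⟨K, _, _, _, _, f, g, hi, he, hs⟩ := exists_exact_finsupp k R2 X2
    have ti : Function.Injective (tensorMap (k := k) (LinearMap.id : X1 →ₗ[R1] X1) f) :=
      tensorMap_id_left_injective hi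
    have te : Function.Exact (tensorMap (k := k) (LinearMap.id : X1 →ₗ[R1] X1) f)
        (tensorMap (k := k) (LinearMap.id : X1 →ₗ[R1] X1) g) :=
      tensorMap_id_left_exact he hs
    have ts : Function.Surjective (tensorMap (k := k) (LinearMap.id : X1 →ₗ[R1] X1) g) :=
      tensorMap_id_left_surjective hs
    exact succ_of_ker ti te ts (hfree _ _ le_rfl)
      (ih (fun ι j hj => hfree ι j (hj.trans n.le_succ))
        (ker_of_succ hi he hs (of_projective _) h))

lemma hom_right_of_tensor (hM : IsTensorAction k R1 R2 M) {n : ℕ}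
    (hfree : ∀ (ι : Type) (j : ℕ), j < n → ExtVanishes (R1 ⊗[k] R2) (X1 ⊗[k] (ι →₀ R2)) M j)
    (h : ExtVanishes (R1 ⊗[k] R2) (X1 ⊗[k] X2) M n) : ExtVanishes R2 X2 (X1 →ₗ[R1] M) n := by
  induction n generalizing X2 with
  | zero =>
    obtain ⟨K, _, _, _, _, f, g, hi, he, hs⟩ := exists_exact_finsupp k R2 X2
    have ti : Function.Injective (tensorMap (k := k) (LinearMap.id : X1 →ₗ[R1] X1) f) :=
      tensorMap_id_left_injective hi
    have te : Function.Exact (tensorMap (k := k) (LinearMap.id : X1 →ₗ[R1] X1) f)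
        (tensorMap (k := k) (LinearMap.id : X1 →ₗ[R1] X1) g) :=
      tensorMap_id_left_exact he hs
    have ts : Function.Surjective (tensorMap (k := k) (LinearMap.id : X1 →ₗ[R1] X1) g) :=
      tensorMap_id_left_surjective hs
    exact zero_of_equiv hi he hs ti te ts
      ((tensorHomEquiv hM).trans biFlip).symm ((tensorHomEquiv hM).trans biFlip).symm
      (fun ψ => ((tensorHomEquiv hM).trans biFlip).injective (by
        rw [Equiv.apply_symm_apply]
        conv_lhs => rw [← ((tensorHomEquiv hM).trans biFlip).apply_symm_apply ψ]
        rfl)) (of_projective _) h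
  | succ n ih =>
    obtain ⟨K, _, _, _, _, f, g, hi, he, hs⟩ := exists_exact_finsupp k R2 X2
    have ti : Function.Injective (tensorMap (k := k) (LinearMap.id : X1 →ₗ[R1] X1) f) :=
      tensorMap_id_left_injective hi
    have te : Function.Exact (tensorMap (k := k) (LinearMap.id : X1 →ₗ[R1] X1) f)
        (tensorMap (k := k) (LinearMap.id : X1 →ₗ[R1] X1) g) :=
      tensorMap_id_left_exact he hs
    have ts : Function.Surjective (tensorMap (k := k) (LinearMap.id : X1 →ₗ[R1] X1) g) :=
      tensorMap_id_left_surjective hs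
    exact succ_of_ker hi he hs (of_projective _)
      (ih (fun ι j hj => hfree ι j (hj.trans n.lt_succ_self))
        (ker_of_succ ti te ts (hfree _ _ n.lt_succ_self) h))

lemma finsupp_tensor (hM : IsTensorAction k R1 R2 M) {n : ℕ} (ι : Type)
    (h : ExtVanishes R2 X2 M n) :
    ExtVanishes (R1 ⊗[k] R2) ((ι →₀ R1) ⊗[k] X2) M n :=
  tensor_of_hom_right hM (fun _ j _ => of_projective j)
    ((h.pi_const ι).congr (.refl _ _) (Finsupp.llift M R1 R2 ι))

lemma tensor_finsupp (hM : IsTensorAction k R1 R2 M) {n : ℕ} (ι : Type)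
    (h : ExtVanishes R1 X1 M n) :
    ExtVanishes (R1 ⊗[k] R2) (X1 ⊗[k] (ι →₀ R2)) M n :=
  tensor_of_hom_left hM (fun _ j _ => of_projective j)
    ((h.pi_const ι).congr (.refl _ _) (Finsupp.llift M R2 R1 ι))

/-- Vanishing of `Ext` over a tensor product from vanishing over the factors. -/
theorem tensor (hM : IsTensorAction k R1 R2 M) (h2 : ∀ n, ExtVanishes R2 X2 M n)
    (h1 : ∀ n, ExtVanishes R1 X1 (X2 →ₗ[R2] M) n) (n : ℕ) :
    ExtVanishes (R1 ⊗[k] R2) (X1 ⊗[k] X2) M n :=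
  tensor_of_hom_left hM (fun ι j _ => finsupp_tensor hM ι (h2 j)) (h1 n)

/-- Vanishing of `Ext` over the factors from vanishing over a tensor product. -/
theorem hom_of_tensor (hM : IsTensorAction k R1 R2 M)
    (h1 : ∀ n, ExtVanishes R1 X1 (X2 →ₗ[R2] M) n → ExtVanishes R1 X1 M n)
    (h2 : ∀ n, ExtVanishes R2 X2 (X1 →ₗ[R1] M) n → ExtVanishes R2 X2 M n)
    (h : ∀ n, ExtVanishes (R1 ⊗[k] R2) (X1 ⊗[k] X2) M n) (n : ℕ) :
    ExtVanishes R1 X1 (X2 →ₗ[R2] M) n ∧ ExtVanishes R2 X2 (X1 →ₗ[R1] M) n := by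
  induction n using Nat.strong_induction_on with
  | _ n ih =>
    exact ⟨hom_left_of_tensor hM
      (fun ι j hj => finsupp_tensor hM ι (h2 j (ih j hj).2)) (h n),
      hom_right_of_tensor hM (fun ι j hj => tensor_finsupp hM ι (h1 j (ih j hj).1)) (h n)⟩

end ExtVanishes

end TensorExt

section Characters

variable {R A B D : Type} [CommRing R] [AddCommGroup A] [Module R A] [AddCommGroup B] [Module R B]
  [AddCommGroup D] [Module R D]

/-- A sequence is exact if and only if its sequence of character modules is exact. -/
lemma CharacterModule.exact_dual_iff {f : A →ₗ[R] B} {g : B →ₗ[R] D} :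
    Function.Exact (CharacterModule.dual g) (CharacterModule.dual f) ↔ Function.Exact f g := by
  constructor
  · intro h
    have hgf (a : A) : g (f a) = 0 := CharacterModule.eq_zero_of_character_apply fun c =>
      DFunLike.congr_fun (h.apply_apply_eq_zero c) a
    refine fun b => ⟨fun hb => ?_, fun ⟨a, ha⟩ => ha ▸ hgf a⟩
    change b ∈ LinearMap.range f
    rw [← Submodule.Quotient.mk_eq_zero]
    refine CharacterModule.eq_zero_of_character_apply fun c => ?_
    obtain ⟨c', hc'⟩ := (h (CharacterModule.dual (LinearMap.range f).mkQ c)).1 (by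
      ext a
      have : (LinearMap.range f).mkQ (f a) = 0 := by simp
      change c ((LinearMap.range f).mkQ (f a)) = 0
      rw [this, map_zero])
    have := DFunLike.congr_fun hc' b
    change c' (g b) = c ((LinearMap.range f).mkQ b) at this
    rw [hb, map_zero] at this
    exact this.symm
  · intro h c
    refine ⟨fun hc => ?_, ?_⟩
    · have hk : (LinearMap.ker g).toAddSubgroup ≤ AddMonoidHom.ker c := fun b hb => by
        obtain ⟨a, rfl⟩ := (h b).1 hb
        exact DFunLike.congr_fun hc a
      obtain ⟨c', hc'⟩ := CharacterModule.dual_surjective_of_injective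
        ((LinearMap.ker g).liftQ g le_rfl)
        (LinearMap.ker_eq_bot.1 (Submodule.ker_liftQ_eq_bot _ _ _ le_rfl))
        (QuotientAddGroup.lift (LinearMap.ker g).toAddSubgroup c hk)
      refine ⟨c', ?_⟩
      ext b
      exact DFunLike.congr_fun hc' (Submodule.Quotient.mk b)
    · rintro ⟨c', rfl⟩
      ext a
      change c' (g (f a)) = 0
      rw [h.apply_apply_eq_zero, map_zero]

/-- Homomorphisms into a character module are characters of the tensor product. -/
noncomputable def homCharacterEquiv (C A : Type) [AddCommGroup C] [Module R C] [AddCommGroup A]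
    [Module R A] : (A →ₗ[R] CharacterModule C) ≃ₗ[R] CharacterModule (C ⊗[R] A) :=
  CharacterModule.homEquiv.trans (CharacterModule.congr (TensorProduct.comm R A C))

lemma dual_lTensor_homCharacterEquiv (C : Type) [AddCommGroup C] [Module R C] (f : A →ₗ[R] B)
    (φ : B →ₗ[R] CharacterModule C) :
    CharacterModule.dual (f.lTensor C) (homCharacterEquiv C B φ) =
      homCharacterEquiv C A (φ ∘ₗ f) := by
  ext x
  induction x with
  | zero => rw [map_zero, map_zero]
  | add x y hx hy => rw [map_add, hx, hy, map_add]
  | tmul x y => rfl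

/-- Exactness of a tensored sequence in terms of homomorphisms to the character module. -/
lemma exact_lTensor_iff (C : Type) [AddCommGroup C] [Module R C] {f : A →ₗ[R] B} {g : B →ₗ[R] D}
    (hgf : g ∘ₗ f = 0) :
    Function.Exact (f.lTensor C) (g.lTensor C) ↔
      ∀ φ : B →ₗ[R] CharacterModule C, φ ∘ₗ f = 0 →
        ∃ ψ : D →ₗ[R] CharacterModule C, ψ ∘ₗ g = φ := by
  rw [← CharacterModule.exact_dual_iff]
  constructor
  · intro h φ hφ
    obtain ⟨c, hc⟩ := (h (homCharacterEquiv C B φ)).1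
      (by rw [dual_lTensor_homCharacterEquiv, hφ, map_zero])
    obtain ⟨ψ, rfl⟩ := (homCharacterEquiv C D).surjective c
    rw [dual_lTensor_homCharacterEquiv] at hc
    exact ⟨ψ, (homCharacterEquiv C B).injective hc⟩
  · intro h c
    obtain ⟨φ, rfl⟩ := (homCharacterEquiv C B).surjective c
    rw [dual_lTensor_homCharacterEquiv, EmbeddingLike.map_eq_zero_iff]
    constructor
    · intro hφ
      obtain ⟨ψ, rfl⟩ := h φ hφ
      exact ⟨homCharacterEquiv C D ψ, dual_lTensor_homCharacterEquiv ..⟩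
    · rintro ⟨c, hc⟩
      obtain ⟨ψ, rfl⟩ := (homCharacterEquiv C D).surjective c
      rw [dual_lTensor_homCharacterEquiv] at hc
      rw [← (homCharacterEquiv C B).injective hc, LinearMap.comp_assoc, hgf, LinearMap.comp_zero]

end Characters

section Resolution

variable {R : Type} [CommRing R] {X M C : Type} [AddCommGroup X] [Module R X]
  [AddCommGroup M] [Module R M] [AddCommGroup C] [Module R C]

lemma extVanishes_iff_of_projectiveResolution (P : ProjectiveResolution (ModuleCat.of R X))
    (n : ℕ) : ExtVanishes R X M n ↔ ∀ φ : P.complex.X (n + 1) ⟶ ModuleCat.of R M,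
      P.complex.d (n + 2) (n + 1) ≫ φ = 0 →
        ∃ ψ : P.complex.X n ⟶ ModuleCat.of R M, P.complex.d (n + 1) n ≫ ψ = φ := by
  constructor
  · intro h φ hφ
    exact (P.extMk_eq_zero_iff φ (n + 2) rfl hφ n rfl).1 (@Subsingleton.elim _ h _ _)
  · intro h
    refine subsingleton_of_forall_eq 0 fun α => ?_
    obtain ⟨φ, hφ, rfl⟩ := P.extMk_surjective α (n + 2) rfl
    exact (P.extMk_eq_zero_iff φ (n + 2) rfl hφ n rfl).2 (h φ hφ)

lemma subsingleton_extGroup_iff (n : ℕ) :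
    Subsingleton (extGroup R X M (n + 1)) ↔ ExtVanishes R X M n := by
  let P := projectiveResolution (ModuleCat.of R X)
  rw [extVanishes_iff_of_projectiveResolution P]
  refine ModuleCat.isZero_iff_subsingleton.symm.trans ?_
  rw [(P.isoExt (R := R) (n + 1) (ModuleCat.of R M)).isZero_iff,
    ← HomologicalComplex.exactAt_iff_isZero_homology,
    HomologicalComplex.exactAt_iff' _ n (n + 1) (n + 2) (by simp) (by simp),
    ShortComplex.moduleCat_exact_iff]
  rfl

lemma subsingleton_torGroup_iff (n : ℕ) :
    Subsingleton (torGroup R C X (n + 1)) ↔ ExtVanishes R X (CharacterModule C) n := by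
  let P := projectiveResolution (ModuleCat.of R X)
  rw [extVanishes_iff_of_projectiveResolution P]
  refine ModuleCat.isZero_iff_subsingleton.symm.trans ?_
  refine ((P.isoLeftDerivedObj ((MonoidalCategory.tensoringLeft _).obj (ModuleCat.of R C))
    (n + 1)).isZero_iff).trans ?_
  refine (HomologicalComplex.exactAt_iff_isZero_homology ..).symm.trans ?_
  rw [HomologicalComplex.exactAt_iff' _ (n + 2) (n + 1) n (by simp) (by simp),
    ShortComplex.ShortExact.moduleCat_exact_iff_function_exact]
  refine (exact_lTensor_iff C (f := (P.complex.d (n + 2) (n + 1)).hom)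
    (g := (P.complex.d (n + 1) n).hom) ?_).trans ?_
  · rw [← ModuleCat.hom_comp, P.complex.d_comp_d]; rfl
  · refine ⟨fun h φ hφ => ?_, fun h φ hφ => ?_⟩
    · obtain ⟨ψ, hψ⟩ := h φ.hom (congrArg ModuleCat.Hom.hom hφ)
      exact ⟨ModuleCat.ofHom ψ, ModuleCat.hom_ext hψ⟩
    · obtain ⟨ψ, hψ⟩ := h (ModuleCat.ofHom φ) (ModuleCat.hom_ext hφ)
      exact ⟨ψ.hom, congrArg ModuleCat.Hom.hom hψ⟩

end Resolution

section HomIntoHom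

variable {k A B : Type} [Field k] [CommRing A] [CommRing B] [Algebra k A] [Algebra k B]
  {D V M N X : Type}
  [AddCommGroup D] [Module k D] [Module A D] [IsScalarTower k A D]
  [AddCommGroup V] [Module k V] [Module B V] [IsScalarTower k B V]
  [AddCommGroup M] [Module A M] [Module B M]
  [AddCommGroup N] [Module B N] [AddCommGroup X] [Module A X]

/-- One direction of the tensor-hom adjunction for homomorphisms into a coinduced module. -/
noncomputable def homToHom (ε : M ≃ₗ[A] (V →ₗ[k] D))
    (hε : ∀ (b : B) m v, ε (b • m) v = ε m (b • v)) (φ : N →ₗ[B] M) : V ⊗[B] N →ₗ[k] D where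
  toFun := TensorProduct.liftAddHom
    (AddMonoidHom.mk' (fun v => AddMonoidHom.mk' (fun n => ε (φ n) v) (by simp)) fun v w => by
      ext; simp)
    (fun b v n => by simp [hε])
  map_add' := map_add _
  map_smul' c x := by
    induction x with
    | zero => simp
    | add x y hx hy => simp_all
    | tmul v n => simp [TensorProduct.smul_tmul']

@[simp]
lemma homToHom_tmul (ε : M ≃ₗ[A] (V →ₗ[k] D)) (hε : ∀ (b : B) m v, ε (b • m) v = ε m (b • v))
    (φ : N →ₗ[B] M) (v : V) (n : N) : homToHom ε hε φ (v ⊗ₜ n) = ε (φ n) v := rfl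

lemma linearMap_ext_tmul {f g : V ⊗[B] N →ₗ[k] D} (h : ∀ v n, f (v ⊗ₜ n) = g (v ⊗ₜ n)) : f = g := by
  ext x
  induction x with
  | zero => rw [map_zero, map_zero]
  | add x y hx hy => rw [map_add, hx, hy, map_add]
  | tmul v n => exact h v n

variable [SMulCommClass A B M] [SMulCommClass B A M]

/-- Tensor-hom adjunction for homomorphisms into a coinduced module. -/
noncomputable def homHomEquiv (ε : M ≃ₗ[A] (V →ₗ[k] D))
    (hε : ∀ (b : B) m v, ε (b • m) v = ε m (b • v)) :
    (N →ₗ[B] M) ≃ₗ[A] (V ⊗[B] N →ₗ[k] D) where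
  toFun := homToHom ε hε
  map_add' φ ψ := linearMap_ext_tmul fun v n => by
    simp only [homToHom_tmul, LinearMap.add_apply, map_add]
  map_smul' a φ := linearMap_ext_tmul fun v n => by
    simp only [homToHom_tmul, LinearMap.smul_apply, map_smul, RingHom.id_apply]
  invFun g :=
    { toFun n := ε.symm
        { toFun v := g (v ⊗ₜ n)
          map_add' := by simp [TensorProduct.add_tmul]
          map_smul' c v := by simp [← TensorProduct.smul_tmul'] }
      map_add' n n' := by
        rw [← map_add]
        congr 1
        ext v
        simp [TensorProduct.tmul_add]
      map_smul' b n := by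
        apply ε.injective
        ext v
        simp [hε, TensorProduct.smul_tmul] }
  left_inv φ := by
    ext n
    apply ε.injective
    ext v
    simp
  right_inv g := linearMap_ext_tmul fun v n => by simp

namespace ExtVanishes

lemma linearMap {n : ℕ} (h : ExtVanishes A X D n) : ExtVanishes A X (V →ₗ[k] D) n :=
  (h.pi_const _).congr (.refl _ _) ((Module.Free.chooseBasis k V).constr A)

lemma of_linearMap [Nontrivial V] {n : ℕ} (h : ExtVanishes A X (V →ₗ[k] D) n) :
    ExtVanishes A X D n :=
  have := (Module.Free.chooseBasis k V).index_nonempty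
  (h.congr (.refl _ _) ((Module.Free.chooseBasis k V).constr A).symm).of_pi_const

end ExtVanishes

end HomIntoHom

section TorTensor

variable {k R1 R2 : Type} [Field k] [CommRing R1] [CommRing R2] [Algebra k R1] [Algebra k R2]
  {X1 X2 C1 C2 : Type}
  [AddCommGroup X1] [Module k X1] [Module R1 X1] [IsScalarTower k R1 X1]
  [AddCommGroup X2] [Module k X2] [Module R2 X2] [IsScalarTower k R2 X2]
  [AddCommGroup C1] [Module k C1] [Module R1 C1] [IsScalarTower k R1 C1]
  [AddCommGroup C2] [Module k C2] [Module R2 C2] [IsScalarTower k R2 C2]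

section Coinduced

variable {M D1 D2 : Type} [AddCommGroup M] [Module k M] [Module R1 M] [Module R2 M]
  [IsScalarTower k R1 M] [IsScalarTower k R2 M] [SMulCommClass R1 R2 M] [SMulCommClass R2 R1 M]
  [Module (R1 ⊗[k] R2) M]
  [AddCommGroup D1] [Module k D1] [Module R1 D1] [IsScalarTower k R1 D1]
  [AddCommGroup D2] [Module k D2] [Module R2 D2] [IsScalarTower k R2 D2]

lemma ExtVanishes.tensor_coinduced {C : Type} [AddCommGroup C] [Module k C]
    (hM : IsTensorAction k R1 R2 M)
    (ε1 : M ≃ₗ[R1] (C2 →ₗ[k] D1)) (hε1 : ∀ (r : R2) m v, ε1 (r • m) v = ε1 m (r • v))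
    (ε2 : M ≃ₗ[R2] (C →ₗ[k] D2))
    (h1 : ∀ n, ExtVanishes R1 X1 D1 n) (h2 : ∀ n, ExtVanishes R2 X2 D2 n) (n : ℕ) :
    ExtVanishes (R1 ⊗[k] R2) (X1 ⊗[k] X2) M n :=
  ExtVanishes.tensor hM (fun n => (h2 n).linearMap.congr (.refl _ _) ε2.symm)
    (fun n => (h1 n).linearMap.congr (.refl _ _) (homHomEquiv ε1 hε1).symm) n

lemma ExtVanishes.of_tensor_coinduced [Nontrivial (C1 ⊗[R1] X1)] [Nontrivial (C2 ⊗[R2] X2)]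
    (hM : IsTensorAction k R1 R2 M)
    (ε1 : M ≃ₗ[R1] (C2 →ₗ[k] D1)) (hε1 : ∀ (r : R2) m v, ε1 (r • m) v = ε1 m (r • v))
    (ε2 : M ≃ₗ[R2] (C1 →ₗ[k] D2)) (hε2 : ∀ (r : R1) m v, ε2 (r • m) v = ε2 m (r • v))
    (h : ∀ n, ExtVanishes (R1 ⊗[k] R2) (X1 ⊗[k] X2) M n) (n : ℕ) :
    ExtVanishes R1 X1 D1 n ∧ ExtVanishes R2 X2 D2 n := by
  have key1 (n : ℕ) (h : ExtVanishes R1 X1 (X2 →ₗ[R2] M) n) : ExtVanishes R1 X1 D1 n :=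
    (h.congr (.refl _ _) (homHomEquiv ε1 hε1)).of_linearMap
  have key2 (n : ℕ) (h : ExtVanishes R2 X2 (X1 →ₗ[R1] M) n) : ExtVanishes R2 X2 D2 n :=
    (h.congr (.refl _ _) (homHomEquiv ε2 hε2)).of_linearMap
  have := ExtVanishes.hom_of_tensor hM
    (fun n h => (key1 n h).linearMap.congr (.refl _ _) ε1.symm)
    (fun n h => (key2 n h).linearMap.congr (.refl _ _) ε2.symm) h n
  exact ⟨key1 n this.1, key2 n this.2⟩

end Coinduced

lemma rightModule_isScalarTower :
    letI := rightModule k R2 C1 C2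
    IsScalarTower k R2 (C1 ⊗[k] C2) :=
  letI := rightModule k R2 C1 C2
  IsScalarTower.of_algebraMap_smul fun r x => by
    change (rightSMul k R2 C1 C2) (algebraMap k R2 r) x = r • x
    rw [AlgHom.commutes]
    simp [Module.algebraMap_end_apply]

lemma isTensorAction_tensor :
    letI := rightModule k R2 C1 C2
    IsTensorAction k R1 R2 (C1 ⊗[k] C2) := fun _ _ _ => rfl

lemma rightModule_smulCommClass :
    letI := rightModule k R2 C1 C2
    SMulCommClass R1 R2 (C1 ⊗[k] C2) :=
  letI := rightModule k R2 C1 C2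
  ⟨fun r s x => by
    induction x with
    | zero => simp
    | add x y hx hy => simp only [smul_add, hx, hy]
    | tmul x y => rfl⟩

instance (C : Type) [AddCommGroup C] [Module k C] [Module R1 C] [IsScalarTower k R1 C] :
    IsScalarTower k R1 (CharacterModule C) :=
  ⟨fun c r φ => by
    ext x
    simp only [CharacterModule.smul_apply]
    rw [smul_assoc, smul_comm]⟩

instance {T : Type} [AddCommGroup T] [Module R1 T] [Module R2 T] [SMulCommClass R1 R2 T] :
    SMulCommClass R1 R2 (CharacterModule T) :=
  ⟨fun r1 r2 φ => by
    ext x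
    simp only [CharacterModule.smul_apply]
    rw [smul_comm r1 r2]⟩

lemma IsTensorAction.character {T : Type} [AddCommGroup T] [Module R1 T] [Module R2 T]
    [SMulCommClass R1 R2 T] [Module (R1 ⊗[k] R2) T] (hT : IsTensorAction k R1 R2 T) :
    IsTensorAction k R1 R2 (CharacterModule T) := fun r1 r2 φ => by
  ext x
  simp only [CharacterModule.smul_apply]
  rw [hT, smul_comm]

variable (k R1 R2 C1 C2) in
/-- Characters of a tensor product over a field as homomorphisms out of the right factor. -/
noncomputable def characterTensorLeft :
    CharacterModule (C1 ⊗[k] C2) ≃ₗ[R1] (C2 →ₗ[k] CharacterModule C1) :=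
  LinearEquiv.symm
    { homCharacterEquiv (R := k) C1 C2 with
      map_smul' := fun r φ => by
        ext x
        induction x with
        | zero => rw [map_zero, map_zero]
        | add x y hx hy => rw [map_add, hx, hy, map_add]
        | tmul x y => rfl }

variable (k R1 R2 C1 C2) in
/-- Characters of a tensor product over a field as homomorphisms out of the left factor. -/
noncomputable def characterTensorRight :
    letI := rightModule k R2 C1 C2
    CharacterModule (C1 ⊗[k] C2) ≃ₗ[R2] (C1 →ₗ[k] CharacterModule C2) :=
  letI := rightModule k R2 C1 C2
  LinearEquiv.symm
    { CharacterModule.homEquiv (R := k) (A := C1) (B := C2) with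
      map_smul' := fun r φ => by
        ext x
        induction x with
        | zero => rw [map_zero, map_zero]
        | add x y hx hy => rw [map_add, hx, hy, map_add]
        | tmul x y => rfl }

theorem ExtVanishes.tensor_character (h1 : ∀ n, ExtVanishes R1 X1 (CharacterModule C1) n)
    (h2 : ∀ n, ExtVanishes R2 X2 (CharacterModule C2) n) (n : ℕ) :
    ExtVanishes (R1 ⊗[k] R2) (X1 ⊗[k] X2) (CharacterModule (C1 ⊗[k] C2)) n :=
  letI := rightModule k R2 C1 C2
  haveI := rightModule_isScalarTower (k := k) (R2 := R2) (C1 := C1) (C2 := C2)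
  haveI := rightModule_smulCommClass (k := k) (R1 := R1) (R2 := R2) (C1 := C1) (C2 := C2)
  haveI := SMulCommClass.symm R1 R2 (C1 ⊗[k] C2)
  tensor_coinduced isTensorAction_tensor.character (characterTensorLeft k R1 C1 C2)
    (fun _ _ _ => rfl) (characterTensorRight k R2 C1 C2) h1 h2 n

theorem ExtVanishes.of_tensor_character [Nontrivial (C1 ⊗[R1] X1)] [Nontrivial (C2 ⊗[R2] X2)]
    (h : ∀ n, ExtVanishes (R1 ⊗[k] R2) (X1 ⊗[k] X2) (CharacterModule (C1 ⊗[k] C2)) n) (n : ℕ) :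
    ExtVanishes R1 X1 (CharacterModule C1) n ∧ ExtVanishes R2 X2 (CharacterModule C2) n :=
  letI := rightModule k R2 C1 C2
  haveI := rightModule_isScalarTower (k := k) (R2 := R2) (C1 := C1) (C2 := C2)
  haveI := rightModule_smulCommClass (k := k) (R1 := R1) (R2 := R2) (C1 := C1) (C2 := C2)
  haveI := SMulCommClass.symm R1 R2 (C1 ⊗[k] C2)
  of_tensor_coinduced isTensorAction_tensor.character (characterTensorLeft k R1 C1 C2)
    (fun _ _ _ => rfl) (characterTensorRight k R2 C1 C2) (fun _ _ _ => rfl) h n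

end TorTensor

section HomIntoTensor

variable {k A B : Type} [Field k] [CommRing A] [CommRing B] [Algebra k A] [Algebra k B]
  {D V M N X : Type}
  [AddCommGroup D] [Module k D] [Module A D] [IsScalarTower k A D]
  [AddCommGroup V] [Module k V] [Module B V] [IsScalarTower k B V]
  [AddCommGroup M] [Module A M] [Module B M] [SMulCommClass B A M]
  [AddCommGroup N] [Module B N] [AddCommGroup X] [Module A X]

open Classical in
lemma equivFinsuppOfBasisLeft_lTensor {ι W : Type} [AddCommGroup W] [Module k W]
    (b : Module.Basis ι k D) (f : V →ₗ[k] W) (t : D ⊗[k] V) (i : ι) :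
    TensorProduct.equivFinsuppOfBasisLeft b (f.lTensor D t) i =
      f (TensorProduct.equivFinsuppOfBasisLeft b t i) := by
  induction t with
  | zero => simp
  | add x y hx hy => simp_all
  | tmul d v => simp

/-- Evaluation of homomorphisms, as a homomorphism. -/
def evalHom (k : Type) [Field k] [Algebra k B] [Module k V] [IsScalarTower k B V] :
    N →+ (N →ₗ[B] V) →ₗ[k] V :=
  AddMonoidHom.mk' (fun n =>
    { toFun f := f n
      map_add' _ _ := rfl
      map_smul' _ _ := rfl }) fun n n' => by ext; simp

@[simp]
lemma evalHom_apply (n : N) (f : N →ₗ[B] V) : evalHom k n f = f n := rfl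

variable (ε : M ≃ₗ[A] D ⊗[k] V)
    (hε : ∀ (b : B) m, ε (b • m) = (Algebra.lsmul k k V b).lTensor D (ε m))

/-- The map from `D ⊗ Hom_B(N, V)` to `Hom_B(N, M)` for a module `M` isomorphic to `D ⊗ V`. -/
noncomputable def tensorHomToHom : D ⊗[k] (N →ₗ[B] V) →ₗ[A] (N →ₗ[B] M) where
  toFun t :=
    { toFun n := ε.symm ((evalHom k n).lTensor D t)
      map_add' n n' := by simp [LinearMap.lTensor_add]
      map_smul' b n := by
        apply ε.injective
        have : evalHom k (b • n) =
            Algebra.lsmul k k V b ∘ₗ (evalHom k n : (N →ₗ[B] V) →ₗ[k] V) := by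
          ext; simp
        simp [hε, this, LinearMap.lTensor_comp] }
  map_add' t t' := by ext; simp
  map_smul' a t := by
    ext n
    apply ε.injective
    simp only [LinearMap.coe_mk, AddHom.coe_mk, LinearEquiv.apply_symm_apply, RingHom.id_apply,
      LinearMap.smul_apply, map_smul]
    exact (TensorProduct.AlgebraTensorModule.lTensor A D (evalHom k n)).map_smul a t

lemma tensorHomToHom_apply (t : D ⊗[k] (N →ₗ[B] V)) (n : N) :
    tensorHomToHom ε hε t n = ε.symm ((evalHom k n).lTensor D t) := rfl

lemma tensorHomToHom_bijective [Module.Finite B N] :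
    Function.Bijective (tensorHomToHom (N := N) ε hε) := by
  classical
  let b := Module.Free.chooseBasis k D
  have coord (t : D ⊗[k] (N →ₗ[B] V)) (n) (i) :
      TensorProduct.equivFinsuppOfBasisLeft b (ε (tensorHomToHom ε hε t n)) i =
        TensorProduct.equivFinsuppOfBasisLeft b t i n := by
    rw [tensorHomToHom_apply, ε.apply_symm_apply, equivFinsuppOfBasisLeft_lTensor, evalHom_apply]
  constructor
  · intro t t' h
    apply (TensorProduct.equivFinsuppOfBasisLeft b).injective
    ext i n
    rw [← coord, h, coord]
  · intro φ
    let c (i) : N →ₗ[B] V :=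
      { toFun n := TensorProduct.equivFinsuppOfBasisLeft b (ε (φ n)) i
        map_add' := by simp
        map_smul' r n := by
          simp only [map_smul, hε, equivFinsuppOfBasisLeft_lTensor, Algebra.lsmul_coe,
            RingHom.id_apply] }
    obtain ⟨s, hs⟩ := (Module.Finite.fg_top : (⊤ : Submodule B N).FG)
    let F := s.biUnion fun x => (TensorProduct.equivFinsuppOfBasisLeft b (ε (φ x))).support
    have hF (i) (hi : c i ≠ 0) : i ∈ F := by
      by_contra h
      refine hi (LinearMap.ext_on (s := s) hs fun x hx => ?_)
      by_contra h'
      exact h (Finset.mem_biUnion.2 ⟨x, hx, Finsupp.mem_support_iff.2 h'⟩)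
    refine ⟨(TensorProduct.equivFinsuppOfBasisLeft b).symm (Finsupp.onFinset F c hF), ?_⟩
    ext n
    apply ε.injective
    apply (TensorProduct.equivFinsuppOfBasisLeft b).injective
    ext i
    rw [coord, LinearEquiv.apply_symm_apply]
    rfl

/-- Homomorphisms from a finite module to a module isomorphic to `D ⊗ V`. -/
noncomputable def tensorHomEquivHom [Module.Finite B N] :
    D ⊗[k] (N →ₗ[B] V) ≃ₗ[A] (N →ₗ[B] M) :=
  LinearEquiv.ofBijective _ (tensorHomToHom_bijective ε hε)

variable (k A D V) in
/-- A tensor product over a field as a direct sum of copies of the left factor. -/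
noncomputable def tensorEquivFinsupp : D ⊗[k] V ≃ₗ[A] (Module.Free.ChooseBasisIndex k V →₀ D) :=
  (TensorProduct.AlgebraTensorModule.congr (.refl A D) (Module.Free.chooseBasis k V).repr).trans
    (TensorProduct.finsuppScalarRight k A D _)

namespace ExtVanishes

lemma tensor_right [IsNoetherianRing A] [Module.Finite A X] {n : ℕ} (h : ExtVanishes A X D n) :
    ExtVanishes A X (D ⊗[k] V) n :=
  (h.finsupp _).congr (.refl _ _) (tensorEquivFinsupp k A D V).symm

lemma of_tensor_right [Nontrivial V] {n : ℕ} (h : ExtVanishes A X (D ⊗[k] V) n) :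
    ExtVanishes A X D n :=
  have := (Module.Free.chooseBasis k V).index_nonempty
  (h.congr (.refl _ _) (tensorEquivFinsupp k A D V)).of_finsupp

end ExtVanishes

end HomIntoTensor

section ExtTensor

variable {k R1 R2 : Type} [Field k] [CommRing R1] [CommRing R2] [Algebra k R1] [Algebra k R2]
  {X1 X2 D1 D2 : Type}
  [AddCommGroup X1] [Module k X1] [Module R1 X1] [IsScalarTower k R1 X1]
  [AddCommGroup X2] [Module k X2] [Module R2 X2] [IsScalarTower k R2 X2]
  [AddCommGroup D1] [Module k D1] [Module R1 D1] [IsScalarTower k R1 D1]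
  [AddCommGroup D2] [Module k D2] [Module R2 D2] [IsScalarTower k R2 D2]

variable (k R2 D1 D2) in
/-- Commutativity of the tensor product, as a map linear over the ring of the right factor. -/
noncomputable def rightModuleComm :
    letI := rightModule k R2 D1 D2
    D1 ⊗[k] D2 ≃ₗ[R2] D2 ⊗[k] D1 :=
  letI := rightModule k R2 D1 D2
  { TensorProduct.comm k D1 D2 with
    map_smul' := fun r x => by
      change TensorProduct.comm k D1 D2 (r • x) = r • TensorProduct.comm k D1 D2 x
      induction x with
      | zero => simp
      | add x y hx hy => rw [smul_add, map_add, hx, hy, map_add, smul_add]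
      | tmul x y => rfl }

lemma rightModule_smul_eq_lTensor (r : R2) (x : D1 ⊗[k] D2) :
    letI := rightModule k R2 D1 D2
    r • x = (Algebra.lsmul k k D2 r).lTensor D1 x := rfl

lemma comm_smul_left {D V : Type} [AddCommGroup D] [Module k D] [Module R1 D]
    [IsScalarTower k R1 D] [AddCommGroup V] [Module k V] (r : R1) (x : D ⊗[k] V) :
    TensorProduct.comm k D V (r • x) =
      (Algebra.lsmul k k D r).lTensor V (TensorProduct.comm k D V x) := by
  induction x with
  | zero => simp
  | add x y hx hy => rw [smul_add, map_add, hx, hy, map_add, map_add]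
  | tmul x y => rfl

namespace ExtVanishes

theorem tensor_tensor [IsNoetherianRing R1] [IsNoetherianRing R2] [Module.Finite R1 X1]
    [Module.Finite R2 X2] (h1 : ∀ n, ExtVanishes R1 X1 D1 n) (h2 : ∀ n, ExtVanishes R2 X2 D2 n)
    (n : ℕ) : ExtVanishes (R1 ⊗[k] R2) (X1 ⊗[k] X2) (D1 ⊗[k] D2) n :=
  letI := rightModule k R2 D1 D2
  haveI := rightModule_isScalarTower (k := k) (R2 := R2) (C1 := D1) (C2 := D2)
  haveI := rightModule_smulCommClass (k := k) (R1 := R1) (R2 := R2) (C1 := D1) (C2 := D2)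
  haveI := SMulCommClass.symm R1 R2 (D1 ⊗[k] D2)
  tensor isTensorAction_tensor
    (fun n => (h2 n).tensor_right.congr (.refl _ _) (rightModuleComm k R2 D1 D2).symm)
    (fun n => (h1 n).tensor_right.congr (.refl _ _)
      (tensorHomEquivHom (.refl R1 (D1 ⊗[k] D2)) rightModule_smul_eq_lTensor)) n

theorem of_tensor_tensor [IsNoetherianRing R1] [IsNoetherianRing R2] [Module.Finite R1 X1]
    [Module.Finite R2 X2] [Nontrivial (X1 →ₗ[R1] D1)] [Nontrivial (X2 →ₗ[R2] D2)]
    (h : ∀ n, ExtVanishes (R1 ⊗[k] R2) (X1 ⊗[k] X2) (D1 ⊗[k] D2) n) (n : ℕ) :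
    ExtVanishes R1 X1 D1 n ∧ ExtVanishes R2 X2 D2 n := by
  let := rightModule k R2 D1 D2
  have := rightModule_isScalarTower (k := k) (R2 := R2) (C1 := D1) (C2 := D2)
  have := rightModule_smulCommClass (k := k) (R1 := R1) (R2 := R2) (C1 := D1) (C2 := D2)
  have := SMulCommClass.symm R1 R2 (D1 ⊗[k] D2)
  have key1 (n : ℕ) (h : ExtVanishes R1 X1 (X2 →ₗ[R2] D1 ⊗[k] D2) n) : ExtVanishes R1 X1 D1 n :=
    (h.congr (.refl _ _)
      (tensorHomEquivHom (.refl R1 (D1 ⊗[k] D2)) rightModule_smul_eq_lTensor).symm).of_tensor_right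
  have key2 (n : ℕ) (h : ExtVanishes R2 X2 (X1 →ₗ[R1] D1 ⊗[k] D2) n) : ExtVanishes R2 X2 D2 n :=
    (h.congr (.refl _ _)
      (tensorHomEquivHom (rightModuleComm k R2 D1 D2) comm_smul_left).symm).of_tensor_right
  have := hom_of_tensor isTensorAction_tensor (fun n h => (key1 n h).tensor_right)
    (fun n h => (key2 n h).tensor_right.congr (.refl _ _) (rightModuleComm k R2 D1 D2).symm) h n
  exact ⟨key1 n this.1, key2 n this.2⟩

end ExtVanishes

variable (k) in
/-- Homomorphisms between tensor products over a field. -/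
noncomputable def homTensorEquiv [Module.Finite R1 X1] [Module.Finite R2 X2] :
    (X1 →ₗ[R1] D1) ⊗[k] (X2 →ₗ[R2] D2) ≃ (X1 ⊗[k] X2 →ₗ[R1 ⊗[k] R2] D1 ⊗[k] D2) :=
  letI := rightModule k R2 D1 D2
  haveI := rightModule_isScalarTower (k := k) (R2 := R2) (C1 := D1) (C2 := D2)
  haveI := rightModule_smulCommClass (k := k) (R1 := R1) (R2 := R2) (C1 := D1) (C2 := D2)
  haveI := SMulCommClass.symm R1 R2 (D1 ⊗[k] D2)
  (TensorProduct.comm k _ _).toEquiv.trans <|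
  (tensorHomEquivHom (A := k) (B := R1) (D := X2 →ₗ[R2] D2) (V := D1) (N := X1)
    (M := X2 →ₗ[R2] D1 ⊗[k] D2)
    (((tensorHomEquivHom (A := R1) (B := R2) (D := D1) (V := D2) (N := X2) (.refl R1 (D1 ⊗[k] D2))
      rightModule_smul_eq_lTensor).symm.restrictScalars k).trans (TensorProduct.comm k _ _))
    fun r ψ => by
      simp only [LinearEquiv.trans_apply, LinearEquiv.restrictScalars_apply, map_smul,
        comm_smul_left]).toEquiv.trans <|
  (tensorHomEquiv isTensorAction_tensor).symm

end ExtTensor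

section TensorTensor

variable {k R1 R2 : Type} [Field k] [CommRing R1] [CommRing R2] [Algebra k R1] [Algebra k R2]
  {C1 C2 N1 N2 : Type}
  [AddCommGroup C1] [Module k C1] [Module R1 C1] [IsScalarTower k R1 C1]
  [AddCommGroup C2] [Module k C2] [Module R2 C2] [IsScalarTower k R2 C2]
  [AddCommGroup N1] [Module k N1] [Module R1 N1] [IsScalarTower k R1 N1]
  [AddCommGroup N2] [Module k N2] [Module R2 N2] [IsScalarTower k R2 N2]

lemma linearMap_ext_outer {M : Type} [AddCommGroup M] [Module (R1 ⊗[k] R2) M]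
    {f g : C1 ⊗[k] C2 →ₗ[R1 ⊗[k] R2] M} (h : ∀ x y, f (x ⊗ₜ y) = g (x ⊗ₜ y)) : f = g := by
  ext x
  induction x with
  | zero => rw [map_zero, map_zero]
  | add x y hx hy => rw [map_add, map_add, hx, hy]
  | tmul x y => exact h x y

variable (k R1 R2 C1 C2 N1 N2) in
/-- The bilinear map underlying `tensorTensorHom`. -/
noncomputable def tensorTensorBilin : C1 ⊗[k] C2 →ₗ[R1 ⊗[k] R2]
    (N1 ⊗[k] N2 →ₗ[R1 ⊗[k] R2] (C1 ⊗[R1] N1) ⊗[k] (C2 ⊗[R2] N2)) :=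
  let β : C1 ⊗[k] C2 →+ (N1 ⊗[k] N2 →ₗ[R1 ⊗[k] R2] (C1 ⊗[R1] N1) ⊗[k] (C2 ⊗[R2] N2)) :=
    TensorProduct.liftAddHom
      (AddMonoidHom.mk' (fun c1 => AddMonoidHom.mk'
        (fun c2 => tensorMap (TensorProduct.mk R1 C1 N1 c1) (TensorProduct.mk R2 C2 N2 c2))
        fun c c' => linearMap_ext_outer fun x y => by simp [TensorProduct.tmul_add])
        fun c c' => by
          ext1 c2
          exact linearMap_ext_outer fun x y => by simp [TensorProduct.add_tmul])
      fun r c1 c2 => linearMap_ext_outer fun x y => by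
        simp [← TensorProduct.smul_tmul', TensorProduct.tmul_smul]
  { β with
    map_smul' := map_smul_of_tmul β fun r1 r2 c1 c2 => linearMap_ext_outer fun x y => by
      have hβ (c1 : C1) (c2 : C2) : β (c1 ⊗ₜ c2) =
          tensorMap (TensorProduct.mk R1 C1 N1 c1) (TensorProduct.mk R2 C2 N2 c2) := rfl
      rw [hβ, hβ, LinearMap.smul_apply, tensorMap_tmul, tensorMap_tmul, tensorModule_smul_tmul,
        map_smul, map_smul, LinearMap.smul_apply, LinearMap.smul_apply] }

variable (k R1 R2 C1 C2 N1 N2) in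
/-- Interchange of tensor products over the factors with the outer tensor product. -/
noncomputable def tensorTensorHom : (C1 ⊗[k] C2) ⊗[R1 ⊗[k] R2] (N1 ⊗[k] N2) →ₗ[R1 ⊗[k] R2]
    (C1 ⊗[R1] N1) ⊗[k] (C2 ⊗[R2] N2) :=
  TensorProduct.lift (tensorTensorBilin k R1 R2 C1 C2 N1 N2)

lemma smul_tmul_left (r : R1) (c1 : C1) (c2 : C2) (n1 : N1) (n2 : N2) :
    (((r • c1) ⊗ₜ[k] c2) ⊗ₜ[R1 ⊗[k] R2] (n1 ⊗ₜ[k] n2)) =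
      ((c1 ⊗ₜ[k] c2) ⊗ₜ[R1 ⊗[k] R2] ((r • n1) ⊗ₜ[k] n2)) := by
  have h := TensorProduct.smul_tmul (R := R1 ⊗[k] R2) (r ⊗ₜ[k] (1 : R2)) (c1 ⊗ₜ[k] c2) (n1 ⊗ₜ[k] n2)
  simpa only [tensorModule_smul_tmul, one_smul] using h

lemma smul_tmul_right (r : R2) (c1 : C1) (c2 : C2) (n1 : N1) (n2 : N2) :
    ((c1 ⊗ₜ[k] (r • c2)) ⊗ₜ[R1 ⊗[k] R2] (n1 ⊗ₜ[k] n2)) =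
      ((c1 ⊗ₜ[k] c2) ⊗ₜ[R1 ⊗[k] R2] (n1 ⊗ₜ[k] (r • n2))) := by
  have h := TensorProduct.smul_tmul (R := R1 ⊗[k] R2) ((1 : R1) ⊗ₜ[k] r) (c1 ⊗ₜ[k] c2) (n1 ⊗ₜ[k] n2)
  simpa only [tensorModule_smul_tmul, one_smul] using h

lemma addHom_ext_tmul {R X Y Q : Type} [CommRing R] [AddCommGroup X] [Module R X]
    [AddCommGroup Y] [Module R Y] [AddCommGroup Q] {f g : X ⊗[R] Y →+ Q}
    (h : ∀ x y, f (x ⊗ₜ y) = g (x ⊗ₜ y)) : f = g := by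
  ext x
  induction x with
  | zero => rw [map_zero, map_zero]
  | add x y hx hy => rw [map_add, map_add, hx, hy]
  | tmul x y => exact h x y

section Interchange

variable {Q : Type} [AddCommGroup Q] (q : C1 ⊗[k] C2 →+ N1 ⊗[k] N2 →+ Q)
  (hq1 : ∀ (r : R1) c1 c2 n1 n2, q ((r • c1) ⊗ₜ c2) (n1 ⊗ₜ n2) = q (c1 ⊗ₜ c2) ((r • n1) ⊗ₜ n2))
  (hq2 : ∀ (r : R2) c1 c2 n1 n2, q (c1 ⊗ₜ (r • c2)) (n1 ⊗ₜ n2) = q (c1 ⊗ₜ c2) (n1 ⊗ₜ (r • n2)))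

/-- Partial application of `interchange` at a pure tensor. -/
noncomputable def interchangeAux (c1 : C1) (n1 : N1) : C2 ⊗[R2] N2 →+ Q :=
  TensorProduct.liftAddHom
    (AddMonoidHom.mk' (fun c2 => AddMonoidHom.mk' (fun n2 => q (c1 ⊗ₜ c2) (n1 ⊗ₜ n2))
      fun n n' => by rw [TensorProduct.tmul_add, map_add])
      fun c c' => by
        ext n2
        simp [TensorProduct.tmul_add])
    fun r c2 n2 => hq2 r c1 c2 n1 n2

lemma interchangeAux_tmul (c1 : C1) (n1 : N1) (c2 : C2) (n2 : N2) :
    interchangeAux q hq2 c1 n1 (c2 ⊗ₜ n2) = q (c1 ⊗ₜ c2) (n1 ⊗ₜ n2) := rfl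

/-- The curried form of `interchange`. -/
noncomputable def interchangeCurried : C1 ⊗[R1] N1 →+ C2 ⊗[R2] N2 →+ Q :=
  TensorProduct.liftAddHom
    (AddMonoidHom.mk' (fun c1 => AddMonoidHom.mk' (fun n1 => interchangeAux q hq2 c1 n1)
      fun n n' => addHom_ext_tmul fun x y => by
        simp only [interchangeAux_tmul, AddMonoidHom.add_apply, map_add, TensorProduct.add_tmul])
      fun c c' => by
        ext1 n1
        exact addHom_ext_tmul fun x y => by
          simp [interchangeAux_tmul, TensorProduct.add_tmul])
    fun r c1 n1 => addHom_ext_tmul fun c2 n2 => hq1 r c1 c2 n1 n2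

lemma interchangeCurried_tmul (c1 : C1) (n1 : N1) (c2 : C2) (n2 : N2) :
    interchangeCurried q hq1 hq2 (c1 ⊗ₜ n1) (c2 ⊗ₜ n2) = q (c1 ⊗ₜ c2) (n1 ⊗ₜ n2) := rfl

lemma interchangeCurried_smul (c : k) (x : C1 ⊗[R1] N1) (y : C2 ⊗[R2] N2) :
    interchangeCurried q hq1 hq2 (c • x) y = interchangeCurried q hq1 hq2 x (c • y) := by
  induction x with
  | zero => rw [smul_zero, map_zero]; rfl
  | add x x' hx hx' => rw [smul_add, map_add, map_add, AddMonoidHom.add_apply, hx, hx',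
      AddMonoidHom.add_apply]
  | tmul c1 n1 =>
    induction y with
    | zero => rw [smul_zero, map_zero, map_zero]
    | add x x' hx hx' => rw [smul_add, map_add, map_add, hx, hx']
    | tmul c2 n2 =>
      rw [TensorProduct.smul_tmul', TensorProduct.smul_tmul', interchangeCurried_tmul,
        interchangeCurried_tmul, TensorProduct.smul_tmul]

/-- A balanced map on outer tensor products induces a map on the tensor product of the factors. -/
noncomputable def interchange : (C1 ⊗[R1] N1) ⊗[k] (C2 ⊗[R2] N2) →+ Q :=
  TensorProduct.liftAddHom (interchangeCurried q hq1 hq2) (interchangeCurried_smul q hq1 hq2)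

end Interchange

variable (k R1 R2 C1 C2 N1 N2) in
/-- The inverse of `tensorTensorHom`. -/
noncomputable def tensorTensorInv : (C1 ⊗[R1] N1) ⊗[k] (C2 ⊗[R2] N2) →+
    (C1 ⊗[k] C2) ⊗[R1 ⊗[k] R2] (N1 ⊗[k] N2) :=
  interchange
    (AddMonoidHom.mk'
      (fun c => (TensorProduct.mk (R1 ⊗[k] R2) (C1 ⊗[k] C2) (N1 ⊗[k] N2) c).toAddMonoidHom)
      fun c c' => by ext n; exact TensorProduct.add_tmul c c' n)
    smul_tmul_left smul_tmul_right

variable (k R1 R2 C1 C2 N1 N2) in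
/-- Interchange of tensor products over the factors with the outer tensor product. -/
noncomputable def tensorTensorEquiv : (C1 ⊗[k] C2) ⊗[R1 ⊗[k] R2] (N1 ⊗[k] N2) ≃ₗ[R1 ⊗[k] R2]
    (C1 ⊗[R1] N1) ⊗[k] (C2 ⊗[R2] N2) where
  __ := tensorTensorHom k R1 R2 C1 C2 N1 N2
  invFun := tensorTensorInv k R1 R2 C1 C2 N1 N2
  left_inv x := by
    change tensorTensorInv k R1 R2 C1 C2 N1 N2 (tensorTensorHom k R1 R2 C1 C2 N1 N2 x) = x
    induction x with
    | zero => rw [map_zero, map_zero]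
    | add x y hx hy => rw [map_add, map_add, hx, hy]
    | tmul x y =>
      induction x with
      | zero => rw [TensorProduct.zero_tmul, map_zero, map_zero]
      | add x y hx hy => rw [TensorProduct.add_tmul, map_add, map_add, hx, hy]
      | tmul c1 c2 =>
        induction y with
        | zero => rw [TensorProduct.tmul_zero, map_zero, map_zero]
        | add x y hx hy => rw [TensorProduct.tmul_add, map_add, map_add, hx, hy]
        | tmul n1 n2 => rfl
  right_inv x := by
    change tensorTensorHom k R1 R2 C1 C2 N1 N2 (tensorTensorInv k R1 R2 C1 C2 N1 N2 x) = x
    induction x with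
    | zero => rw [map_zero, map_zero]
    | add x y hx hy => rw [map_add, map_add, hx, hy]
    | tmul x y =>
      induction x with
      | zero => rw [TensorProduct.zero_tmul, map_zero, map_zero]
      | add x y hx hy => rw [TensorProduct.add_tmul, map_add, map_add, hx, hy]
      | tmul c1 n1 =>
        induction y with
        | zero => rw [TensorProduct.tmul_zero, map_zero, map_zero]
        | add x y hx hy => rw [TensorProduct.tmul_add, map_add, map_add, hx, hy]
        | tmul c2 n2 => rfl

end TensorTensor

section Unit

variable {k R1 R2 : Type} [Field k] [CommRing R1] [CommRing R2] [Algebra k R1] [Algebra k R2]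
  {C1 C2 N1 N2 : Type}
  [AddCommGroup C1] [Module k C1] [Module R1 C1] [IsScalarTower k R1 C1]
  [AddCommGroup C2] [Module k C2] [Module R2 C2] [IsScalarTower k R2 C2]
  [AddCommGroup N1] [Module k N1] [Module R1 N1] [IsScalarTower k R1 N1]
  [AddCommGroup N2] [Module k N2] [Module R2 N2] [IsScalarTower k R2 N2]

lemma homTensorEquiv_add {D1 D2 : Type}
    [AddCommGroup D1] [Module k D1] [Module R1 D1] [IsScalarTower k R1 D1]
    [AddCommGroup D2] [Module k D2] [Module R2 D2] [IsScalarTower k R2 D2]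
    [Module.Finite R1 C1] [Module.Finite R2 C2] (s t : (C1 →ₗ[R1] D1) ⊗[k] (C2 →ₗ[R2] D2)) :
    homTensorEquiv k (s + t) = homTensorEquiv k s + homTensorEquiv k t := by
  refine linearMap_ext_outer fun x y => ?_
  simp only [homTensorEquiv, Equiv.trans_apply, LinearEquiv.coe_toEquiv, map_add]
  rfl

lemma homTensorEquiv_zero {D1 D2 : Type}
    [AddCommGroup D1] [Module k D1] [Module R1 D1] [IsScalarTower k R1 D1]
    [AddCommGroup D2] [Module k D2] [Module R2 D2] [IsScalarTower k R2 D2]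
    [Module.Finite R1 C1] [Module.Finite R2 C2] :
    homTensorEquiv k (0 : (C1 →ₗ[R1] D1) ⊗[k] (C2 →ₗ[R2] D2)) = 0 := by
  refine linearMap_ext_outer fun x y => ?_
  simp only [homTensorEquiv, Equiv.trans_apply, LinearEquiv.coe_toEquiv, map_zero]
  rfl

lemma tensorTensorEquiv_comp_unit [Module.Finite R1 C1] [Module.Finite R2 C2] (x : N1 ⊗[k] N2) :
    (tensorTensorEquiv k R1 R2 C1 C2 N1 N2).toLinearMap ∘ₗ
      (TensorProduct.mk (R1 ⊗[k] R2) (C1 ⊗[k] C2) (N1 ⊗[k] N2)).flip x =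
    homTensorEquiv k (tensorMap (k := k) (TensorProduct.mk R1 C1 N1).flip
      (TensorProduct.mk R2 C2 N2).flip x) := by
  induction x with
  | zero =>
    rw [map_zero, LinearMap.comp_zero, map_zero, homTensorEquiv_zero]
  | add x y hx hy => rw [map_add, LinearMap.comp_add, hx, hy, map_add, homTensorEquiv_add]
  | tmul n1 n2 => exact linearMap_ext_outer fun c1 c2 => rfl

lemma unit_bijective_iff [Module.Finite R1 C1] [Module.Finite R2 C2] :
    Function.Bijective (TensorProduct.mk (R1 ⊗[k] R2) (C1 ⊗[k] C2) (N1 ⊗[k] N2)).flip ↔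
      Function.Bijective (tensorMap (k := k) (TensorProduct.mk R1 C1 N1).flip
        (TensorProduct.mk R2 C2 N2).flip) := by
  rw [← (homTensorEquiv k).bijective.of_comp_iff',
    ← (tensorTensorEquiv k R1 R2 C1 C2 N1 N2).congrRight.bijective.of_comp_iff']
  exact iff_of_eq (congrArg _ (funext tensorTensorEquiv_comp_unit))

lemma tensorMap_bijective {f : C1 →ₗ[R1] N1} {g : C2 →ₗ[R2] N2} (hf : Function.Bijective f)
    (hg : Function.Bijective g) : Function.Bijective (tensorMap (k := k) f g) :=
  (tensorCongr (k := k) (.ofBijective f hf) (.ofBijective g hg)).bijective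

lemma bijective_of_tensorMap [Nontrivial C1] [Nontrivial C2] {f : C1 →ₗ[R1] N1} {g : C2 →ₗ[R2] N2}
    (h : Function.Bijective (tensorMap (k := k) f g)) :
    Function.Bijective f ∧ Function.Bijective g := by
  have h : Function.Bijective (TensorProduct.map (f.restrictScalars k) (g.restrictScalars k)) := h
  have : Nontrivial (C1 ⊗[k] C2) := Module.FaithfullyFlat.lTensor_nontrivial k C1 C2
  have : Nontrivial (N1 ⊗[k] N2) := h.injective.nontrivial
  have : Nontrivial N1 := by
    by_contra hN
    rw [not_nontrivial_iff_subsingleton] at hN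
    exact not_subsingleton (N1 ⊗[k] N2) inferInstance
  have : Nontrivial N2 := by
    by_contra hN
    rw [not_nontrivial_iff_subsingleton] at hN
    exact not_subsingleton (N1 ⊗[k] N2) inferInstance
  have hfg := h
  rw [← LinearMap.lTensor_comp_rTensor, LinearMap.coe_comp] at hfg
  rw [← LinearMap.rTensor_comp_lTensor, LinearMap.coe_comp] at h
  refine ⟨⟨?_, ?_⟩, ?_, ?_⟩
  · have := hfg.injective.of_comp
    rwa [← LinearMap.lTensor_inj_iff_rTensor_inj,
      Module.FaithfullyFlat.lTensor_injective_iff_injective] at this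
  · have := h.surjective.of_comp
    rwa [← LinearMap.lTensor_surj_iff_rTensor_surj,
      Module.FaithfullyFlat.lTensor_surjective_iff_surjective] at this
  · exact (Module.FaithfullyFlat.lTensor_injective_iff_injective k C1 _).1 h.injective.of_comp
  · exact (Module.FaithfullyFlat.lTensor_surjective_iff_surjective k N1 _).1 hfg.surjective.of_comp

end Unit

lemma memAuslanderClass_iff {R : Type} [CommRing R] {C M : Type} [AddCommGroup C] [Module R C]
    [AddCommGroup M] [Module R M] :
    MemAuslanderClass R C M ↔ Function.Bijective (TensorProduct.mk R C M).flip ∧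
      (∀ n, ExtVanishes R M (CharacterModule C) n) ∧ ∀ n, ExtVanishes R C (C ⊗[R] M) n := by
  have key (p : ℕ → Prop) : (∀ i, 0 < i → p i) ↔ ∀ n, p (n + 1) :=
    ⟨fun h n => h _ n.succ_pos, fun h i hi => Nat.succ_pred_eq_of_pos hi ▸ h _⟩
  simp only [MemAuslanderClass, key, subsingleton_torGroup_iff, subsingleton_extGroup_iff]

lemma nontrivial_of_nontrivial_hom {R : Type} [CommRing R] (C M : Type) [AddCommGroup C]
    [Module R C] [AddCommGroup M] [Module R M] [Nontrivial (C →ₗ[R] M)] : Nontrivial M := by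
  by_contra h
  rw [not_nontrivial_iff_subsingleton] at h
  exact not_subsingleton (C →ₗ[R] M) inferInstance

open TensorProduct in
/-- Let `k` be a field, `R1`, `R2` nonzero commutative noetherian `k`-algebras,
`C1`, `C2` semidualizing modules over `R1`, `R2` respectively, and `N1`, `N2` modules
over `R1`, `R2` respectively.  If `N1 ∈ A_{C1}(R1)` and `N2 ∈ A_{C2}(R2)` then
`N1 ⊗[k] N2 ∈ A_{C1 ⊗[k] C2}(R1 ⊗[k] R2)`; conversely, if `N1 ≠ 0 ≠ N2` and
`N1 ⊗[k] N2 ∈ A_{C1 ⊗[k] C2}(R1 ⊗[k] R2)`, then `N1 ∈ A_{C1}(R1)` and `N2 ∈ A_{C2}(R2)`. -/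
theorem memAuslanderClass_tensorProduct
    (k : Type) [Field k] (R1 R2 : Type) [CommRing R1] [CommRing R2]
    [Algebra k R1] [Algebra k R2] [Nontrivial R1] [Nontrivial R2]
    [IsNoetherianRing R1] [IsNoetherianRing R2]
    (C1 C2 : Type) [AddCommGroup C1] [Module k C1] [Module R1 C1] [IsScalarTower k R1 C1]
    [AddCommGroup C2] [Module k C2] [Module R2 C2] [IsScalarTower k R2 C2]
    (hC1 : IsSemidualizing R1 C1) (hC2 : IsSemidualizing R2 C2)
    (N1 N2 : Type) [AddCommGroup N1] [Module k N1] [Module R1 N1] [IsScalarTower k R1 N1]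
    [AddCommGroup N2] [Module k N2] [Module R2 N2] [IsScalarTower k R2 N2] :
    (MemAuslanderClass R1 C1 N1 → MemAuslanderClass R2 C2 N2 →
      MemAuslanderClass (R1 ⊗[k] R2) (C1 ⊗[k] C2) (N1 ⊗[k] N2)) ∧
    (Nontrivial N1 → Nontrivial N2 →
      MemAuslanderClass (R1 ⊗[k] R2) (C1 ⊗[k] C2) (N1 ⊗[k] N2) →
      MemAuslanderClass R1 C1 N1 ∧ MemAuslanderClass R2 C2 N2) := by
  have := hC1.1
  have := hC2.1
  simp only [memAuslanderClass_iff, unit_bijective_iff (k := k)]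
  refine ⟨fun ⟨u1, t1, e1⟩ ⟨u2, t2, e2⟩ => ⟨tensorMap_bijective u1 u2, .tensor_character t1 t2,
    fun n => (ExtVanishes.tensor_tensor e1 e2 n).congr (.refl _ _)
      (tensorTensorEquiv k R1 R2 C1 C2 N1 N2).symm⟩, fun _ _ ⟨u, t, e⟩ => ?_⟩
  obtain ⟨u1, u2⟩ := bijective_of_tensorMap u
  have := u1.injective.nontrivial
  have := u2.injective.nontrivial
  have := nontrivial_of_nontrivial_hom (R := R1) C1 (C1 ⊗[R1] N1)
  have := nontrivial_of_nontrivial_hom (R := R2) C2 (C2 ⊗[R2] N2)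
  have t := ExtVanishes.of_tensor_character t
  have e := ExtVanishes.of_tensor_tensor fun n =>
    (e n).congr (.refl _ _) (tensorTensorEquiv k R1 R2 C1 C2 N1 N2)
  exact ⟨⟨u1, fun n => (t n).1, fun n => (e n).1⟩, u2, fun n => (t n).2, fun n => (e n).2⟩
end

section
/- Let R be a commutative noetherian local ring and let B and C be semidualizing R-modules. If B belongs to the Bass class B_C(R) and C belongs to the Bass class B_B(R), then B and C are isomorphic as R-modules. -/
open CategoryTheory
section BassAuslander

open TensorProduct

variable (R : Type) [CommRing R]

/-- `M` belongs to the Bass class `B_C(R)`: the evaluation map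
`C ⊗_R Hom_R(C,M) → M`, `c ⊗ f ↦ f c`, is bijective, and
`Ext_R^i(C,M) = 0 = Tor_i^R(C, Hom_R(C,M))` for all `i > 0`. -/
noncomputable def MemBassClass (C M : Type) [AddCommGroup C] [Module R C]
    [AddCommGroup M] [Module R M] : Prop :=
  Function.Bijective (TensorProduct.lift
    ((LinearMap.id : (C →ₗ[R] M) →ₗ[R] (C →ₗ[R] M)).flip) : C ⊗[R] (C →ₗ[R] M) → M) ∧
  (∀ i : ℕ, 0 < i → Subsingleton (extGroup R C M i)) ∧
  (∀ i : ℕ, 0 < i → Subsingleton (torGroup R C (C →ₗ[R] M) i))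

end BassAuslander

theorem MemBassClass.surjective_of_span_singleton_eq_top {R : Type} [CommRing R] {M N : Type}
    [AddCommGroup M] [Module R M] [AddCommGroup N] [Module R N]
    (h : MemBassClass R M N) {u : M →ₗ[R] N} (hu : Submodule.span R {u} = ⊤) :
    Function.Surjective u := by
  rw [← LinearMap.range_eq_top, eq_top_iff]
  intro n _
  obtain ⟨t, rfl⟩ := h.1.2 n
  induction t with
  | zero => simp
  | add x y hx hy => rw [map_add]; exact add_mem (hx trivial) (hy trivial)
  | tmul m f =>
    obtain ⟨r, rfl⟩ := Submodule.mem_span_singleton.mp (hu ▸ Submodule.mem_top (x := f))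
    exact ⟨r • m, by simp⟩

section LocalRing

open TensorProduct IsLocalRing

variable {R : Type} [CommRing R] [IsLocalRing R]

theorem finrank_residueField_tensorProduct_mul (M N : Type) [AddCommGroup M] [Module R M]
    [AddCommGroup N] [Module R N] :
    Module.finrank (ResidueField R) (ResidueField R ⊗[R] (M ⊗[R] N)) =
      Module.finrank (ResidueField R) (ResidueField R ⊗[R] M) *
        Module.finrank (ResidueField R) (ResidueField R ⊗[R] N) := by
  rw [(AlgebraTensorModule.distribBaseChange R (ResidueField R) M N).finrank_eq,
    Module.finrank_tensorProduct]

theorem finrank_residueField_tensorProduct_pos (M : Type) [AddCommGroup M] [Module R M]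
    [Module.Finite R M] [Nontrivial M] :
    0 < Module.finrank (ResidueField R) (ResidueField R ⊗[R] M) := by
  refine Nat.pos_of_ne_zero fun h => not_subsingleton M ?_
  rw [Module.finrank_zero_iff, subsingleton_tensorProduct] at h
  exact h

theorem exists_span_singleton_eq_top_of_finrank_eq_one {M : Type} [AddCommGroup M] [Module R M]
    [Module.Finite R M] (h : Module.finrank (ResidueField R) (ResidueField R ⊗[R] M) = 1) :
    ∃ u : M, Submodule.span R {u} = ⊤ := by
  obtain ⟨v, -, hv⟩ := finrank_eq_one_iff'.mp h
  obtain ⟨u, rfl⟩ := TensorProduct.mk_surjective R M (ResidueField R) residue_surjective v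
  refine ⟨u, map_tensorProduct_mk_eq_top.mp (eq_top_iff.mpr fun w _ => ?_)⟩
  obtain ⟨c, rfl⟩ := hv w
  obtain ⟨r, rfl⟩ := residue_surjective c
  refine ⟨r • u, Submodule.smul_mem _ _ (Submodule.mem_span_singleton_self u), ?_⟩
  rw [map_smul, ← ResidueField.algebraMap_eq, algebraMap_smul]

theorem MemBassClass.finrank_residueField_tensorProduct {M N : Type} [AddCommGroup M]
    [Module R M] [AddCommGroup N] [Module R N] (h : MemBassClass R M N) :
    Module.finrank (ResidueField R) (ResidueField R ⊗[R] N) =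
      Module.finrank (ResidueField R) (ResidueField R ⊗[R] M) *
        Module.finrank (ResidueField R) (ResidueField R ⊗[R] (M →ₗ[R] N)) := by
  rw [← finrank_residueField_tensorProduct_mul]
  exact ((LinearEquiv.ofBijective _ h.1).baseChange R (ResidueField R) _ _).finrank_eq.symm

theorem IsSemidualizing.nontrivial {M : Type} [AddCommGroup M] [Module R M]
    (h : IsSemidualizing R M) : Nontrivial M := by
  by_contra hM
  rw [not_nontrivial_iff_subsingleton] at hM
  exact one_ne_zero (h.2.1.1 (Subsingleton.elim (LinearMap.lsmul R M 1) (LinearMap.lsmul R M 0)))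

end LocalRing

/-- Let `R` be a commutative noetherian local ring and `B`, `C` semidualizing
`R`-modules.  If `B ∈ B_C(R)` and `C ∈ B_B(R)`, then `B ≅ C` as `R`-modules. -/
theorem semidualizing_isomorphic_of_memBassClass
    (R : Type) [CommRing R] [IsNoetherianRing R] [IsLocalRing R]
    (B C : Type) [AddCommGroup B] [Module R B] [AddCommGroup C] [Module R C]
    (hB : IsSemidualizing R B) (hC : IsSemidualizing R C)
    (hBC : MemBassClass R C B) (hCB : MemBassClass R B C) :
    Nonempty (B ≃ₗ[R] C) := by
  have := hB.1
  have := hC.1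
  have := hC.nontrivial
  have hBr := hBC.finrank_residueField_tensorProduct
  have hCr := hCB.finrank_residueField_tensorProduct
  have hpos := finrank_residueField_tensorProduct_pos (R := R) C
  have hmul : _ * _ = 1 := Nat.eq_of_mul_eq_mul_left hpos <| by
    rw [← mul_assoc, ← hBr, ← hCr, mul_one]
  obtain ⟨u, hu⟩ := exists_span_singleton_eq_top_of_finrank_eq_one
    (Nat.eq_one_of_mul_eq_one_right hmul)
  obtain ⟨v, hv⟩ := exists_span_singleton_eq_top_of_finrank_eq_one
    (Nat.eq_one_of_mul_eq_one_left hmul)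
  have hu' := hBC.surjective_of_span_singleton_eq_top hu
  have hv' := hCB.surjective_of_span_singleton_eq_top hv
  have hinj : Function.Injective (v ∘ u) :=
    IsNoetherian.injective_of_surjective_endomorphism (v ∘ₗ u) (hv'.comp hu')
  exact ⟨(LinearEquiv.ofBijective u ⟨Function.Injective.of_comp hinj, hu'⟩).symm⟩
end
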